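/- arXiv:2605.21761 — 3 statements merged into one kernel-verified Lean document; each statement's English description precedes it below -/
import Mathlib

section
/- Let φ be a circle covering map of degree two, not topologically conjugate to the doubling map, such that the collection of all maximal periodic intervals of φ is finite and nonempty, say I₁,…,I_r, and set Λ := 𝕊¹ \ ⋃_{n≥0} φ^{-n}(I₁ ∪ ⋯ ∪ I_r). Let x₀ ∈ Λ be a fixed point of φ. If (x₀, x₀+ε) ∩ Λ ≠ ∅ for every ε > 0, then for every δ > 0 there exists a nice interval of length less than δ whose left endpoint is x₀. The analogous statement holds (with right endpoint x₀) if (x₀−ε, x₀) ∩ Λ ≠ ∅ for every ε > 0. -/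
open Set Filter MeasureTheory Topology

noncomputable section

/-- `F : ℝ → ℝ` is a lift of `φ : 𝕊¹ → 𝕊¹` witnessing that `φ` is a
circle covering map of degree two. -/
def IsLiftDeg2 (φ : UnitAddCircle → UnitAddCircle) (F : ℝ → ℝ) : Prop :=
  Continuous F ∧ StrictMono F ∧ (∀ x : ℝ, F (x + 1) = F x + 2) ∧
    ∀ x : ℝ, φ (x : UnitAddCircle) = ((F x : ℝ) : UnitAddCircle)

/-- The closed arc on the circle starting at `a` (counterclockwise) of length `ℓ`. -/
def closedArc (a ℓ : ℝ) : Set UnitAddCircle :=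
  (fun t : ℝ => (t : UnitAddCircle)) '' Set.Icc a (a + ℓ)

/-- The open arc on the circle starting at `a` (counterclockwise) of length `ℓ`. -/
def openArc (a ℓ : ℝ) : Set UnitAddCircle :=
  (fun t : ℝ => (t : UnitAddCircle)) '' Set.Ioo a (a + ℓ)

/-- The open arc `(x, x + ε)` counterclockwise. -/
def rightArc (x : UnitAddCircle) (ε : ℝ) : Set UnitAddCircle :=
  {y | ∃ t : ℝ, 0 < t ∧ t < ε ∧ y = x + (t : UnitAddCircle)}

/-- The open arc `(x - ε, x)` counterclockwise. -/
def leftArc (x : UnitAddCircle) (ε : ℝ) : Set UnitAddCircle :=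
  {y | ∃ t : ℝ, 0 < t ∧ t < ε ∧ y = x - (t : UnitAddCircle)}

/-- `I` is a periodic interval of `φ` of period `s`: a proper nondegenerate closed arc
mapped onto itself homeomorphically by `φ^s`. -/
def IsPeriodicInterval (φ : UnitAddCircle → UnitAddCircle) (s : ℕ)
    (I : Set UnitAddCircle) : Prop :=
  1 ≤ s ∧ (∃ a ℓ : ℝ, 0 < ℓ ∧ ℓ < 1 ∧ I = closedArc a ℓ) ∧ Set.BijOn (φ^[s]) I I

/-- A maximal periodic interval of `φ`. -/
def IsMaxPeriodicInterval (φ : UnitAddCircle → UnitAddCircle)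
    (I : Set UnitAddCircle) : Prop :=
  (∃ s, IsPeriodicInterval φ s I) ∧ ∀ J, (∃ s, IsPeriodicInterval φ s J) → I ⊆ J → I = J

/-- `Λ = 𝕊¹ \ ⋃ₙ φ⁻ⁿ(I₁ ∪ ⋯ ∪ I_r)`, the complement of all preimages of the
maximal periodic intervals. -/
def lambdaSet (φ : UnitAddCircle → UnitAddCircle) : Set UnitAddCircle :=
  Set.univ \ ⋃ n : ℕ, (φ^[n]) ⁻¹' (⋃ I ∈ {I | IsMaxPeriodicInterval φ I}, I)

/-- The doubling map `x ↦ 2x (mod 1)`. -/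
def doubling : UnitAddCircle → UnitAddCircle := fun x => x + x

/-- `φ` is topologically conjugate to the doubling map. -/
def ConjugateToDoubling (φ : UnitAddCircle → UnitAddCircle) : Prop :=
  ∃ h : UnitAddCircle ≃ₜ UnitAddCircle, ∀ x, h (φ x) = doubling (h x)

/-- `I` is a `φ`-dyadic interval of degree `n` (described via the lift `F` of `φ`):
a closed arc whose endpoints are consecutive `φⁿ`-preimages of `0`. -/
def IsDyadic (F : ℝ → ℝ) (n : ℕ) (I : Set UnitAddCircle) : Prop :=
  ∃ a b : ℝ, a < b ∧ (∃ k : ℤ, F^[n] a = (k : ℝ)) ∧ F^[n] b = F^[n] a + 1 ∧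
    I = (fun t : ℝ => (t : UnitAddCircle)) '' Set.Icc a b

/-- `G` is a lift of the orientation-preserving circle homeomorphism `g`. -/
def IsOPLift (g : UnitAddCircle → UnitAddCircle) (G : ℝ → ℝ) : Prop :=
  Continuous G ∧ StrictMono G ∧ (∀ x : ℝ, G (x + 1) = G x + 1) ∧
    ∀ x : ℝ, g (x : UnitAddCircle) = ((G x : ℝ) : UnitAddCircle)

/-- `g` belongs to the Ghys–Sergiescu Thompson group `T_φ` (with `F` a lift of `φ`):
`g` is an orientation-preserving circle homeomorphism and there are partitions of the
circle into `φ`-dyadic intervals `I k`, `J k` such that `g` maps `I k` onto `J k` and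
`g = φ_{J k}⁻¹ ∘ φ_{I k}` on `I k`, i.e. `φ^[m k] ∘ g = φ^[n k]` on `I k`. -/
def InThompsonGroup (φ : UnitAddCircle → UnitAddCircle) (F : ℝ → ℝ)
    (g : UnitAddCircle → UnitAddCircle) : Prop :=
  (∃ G : ℝ → ℝ, IsOPLift g G) ∧
  ∃ (r : ℕ) (I J : Fin r → Set UnitAddCircle) (n m : Fin r → ℕ),
    0 < r ∧
    (∀ k, IsDyadic F (n k) (I k)) ∧ (∀ k, IsDyadic F (m k) (J k)) ∧
    (⋃ k, I k) = Set.univ ∧ (⋃ k, J k) = Set.univ ∧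
    (Pairwise fun k l => interior (I k) ∩ interior (I l) = ∅) ∧
    (Pairwise fun k l => interior (J k) ∩ interior (J l) = ∅) ∧
    (∀ k, g '' I k = J k) ∧ (∀ k, ∀ x ∈ I k, φ^[m k] (g x) = φ^[n k] x)

/-- `x` is a nonexpandable point for the action of `T_φ`: `g′(x) ≤ 1` for every
`g ∈ T_φ` (derivatives are computed via lifts). -/
def NonExpandable (φ : UnitAddCircle → UnitAddCircle) (F : ℝ → ℝ)
    (x : UnitAddCircle) : Prop :=
  ∀ g G, InThompsonGroup φ F g → IsOPLift g G →
    ∀ x' : ℝ, (x' : UnitAddCircle) = x → deriv G x' ≤ 1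

/-- `I` is nice for `φ`: no forward iterate of the boundary returns to the interior. -/
def IsNice (φ : UnitAddCircle → UnitAddCircle) (I : Set UnitAddCircle) : Prop :=
  ∀ n : ℕ, 1 ≤ n → (φ^[n]) '' (frontier I) ∩ interior I = ∅

/-- A nice interval: a proper nondegenerate closed arc that is nice. -/
def IsNiceInterval (φ : UnitAddCircle → UnitAddCircle) (I : Set UnitAddCircle) : Prop :=
  (∃ a ℓ : ℝ, 0 < ℓ ∧ ℓ < 1 ∧ I = closedArc a ℓ) ∧ IsNice φ I

/-- `J` is a connected component of `S`. -/
def IsComponentOf (J S : Set UnitAddCircle) : Prop :=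
  ∃ x ∈ S, J = connectedComponentIn S x

/-- The set of left endpoints of connected components of `𝕊¹ \ Λ`. -/
def leftEndpoints (Λ : Set UnitAddCircle) : Set UnitAddCircle :=
  {z | ∃ C : Set UnitAddCircle, IsComponentOf C (Set.univ \ Λ) ∧
    ∃ a ℓ : ℝ, 0 < ℓ ∧ ℓ ≤ 1 ∧ C = openArc a ℓ ∧ z = (a : UnitAddCircle)}

/-- The set of right endpoints of connected components of `𝕊¹ \ Λ`. -/
def rightEndpoints (Λ : Set UnitAddCircle) : Set UnitAddCircle :=
  {z | ∃ C : Set UnitAddCircle, IsComponentOf C (Set.univ \ Λ) ∧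
    ∃ a ℓ : ℝ, 0 < ℓ ∧ ℓ ≤ 1 ∧ C = openArc a ℓ ∧ z = ((a + ℓ : ℝ) : UnitAddCircle)}

/-- `x` is a parabolic periodic point of `φ`: `φ^s(x) = x` and `(φ^s)′(x) = 1`
(the derivative computed via the lift `F`). -/
def IsParabolicPeriodicPt (φ : UnitAddCircle → UnitAddCircle) (F : ℝ → ℝ)
    (x : UnitAddCircle) : Prop :=
  ∃ s : ℕ, 1 ≤ s ∧ φ^[s] x = x ∧
    ∀ x' : ℝ, (x' : UnitAddCircle) = x → deriv (F^[s]) x' = 1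

/-- Real-line properties of the lift of a degree-two circle covering map. -/
structure IsDeg2Map (F : ℝ → ℝ) : Prop where
  continuous : Continuous F
  strictMono : StrictMono F
  map_add_one : ∀ x, F (x + 1) = F x + 2

namespace IsDeg2Map

variable {F : ℝ → ℝ}

theorem map_add_int (hF : IsDeg2Map F) (x : ℝ) (k : ℤ) : F (x + k) = F x + 2 * k := by
  induction k using Int.induction_on with
  | zero => simp
  | succ i ih =>
    have := hF.map_add_one (x + i)
    push_cast at *
    rw [← add_assoc, this, ih]; ring
  | pred i ih =>
    have := hF.map_add_one (x + (-(i : ℝ) - 1))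
    push_cast at *
    rw [show x + (-(i : ℝ) - 1) + 1 = x + -(i : ℝ) by ring, ih] at this
    linarith

theorem reflect (hF : IsDeg2Map F) : IsDeg2Map fun x => -F (-x) where
  continuous := (hF.continuous.comp continuous_neg).neg
  strictMono := fun _ _ h => neg_lt_neg (hF.strictMono (neg_lt_neg h))
  map_add_one := fun x => by
    have := hF.map_add_one (-(x + 1))
    rw [show -(x + 1) + 1 = -x by ring] at this
    linarith

theorem lt_map_of_add_one_le (hF : IsDeg2Map F) {a x : ℝ} (ha : F a = a) (hx : a + 1 ≤ x) :
    x < F x := by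
  have h1 : (1 : ℝ) ≤ ⌊x - a⌋ := by
    exact_mod_cast Int.le_floor.2 (by push_cast; linarith)
  have h2 := hF.map_add_int a ⌊x - a⌋
  have h3 := hF.strictMono.monotone (show a + ⌊x - a⌋ ≤ x by linarith [Int.floor_le (x - a)])
  linarith [Int.lt_floor_add_one (x - a)]

theorem map_lt_of_le_sub_one (hF : IsDeg2Map F) {a x : ℝ} (ha : F a = a) (hx : x ≤ a - 1) :
    F x < x := by
  have := hF.reflect.lt_map_of_add_one_le (a := -a) (x := -x) (by simp [ha]) (by linarith)
  simp only [neg_neg] at this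
  linarith

theorem exists_fixed_ge (hF : IsDeg2Map F) {a x : ℝ} (ha : F a = a) (hx : F x ≤ x) :
    ∃ p, x ≤ p ∧ F p = p := by
  have hxa : x ≤ a + 1 := by
    by_contra! h
    linarith [hF.lt_map_of_add_one_le ha h.le]
  obtain ⟨p, hp, h⟩ := intermediate_value_Icc hxa
    (hF.continuous.sub continuous_id).continuousOn
    (show (0 : ℝ) ∈ Icc _ _ from ⟨by simpa using hx,
      by simpa using (hF.lt_map_of_add_one_le ha le_rfl).le⟩)
  exact ⟨p, hp.1, by simpa [sub_eq_zero] using h⟩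

theorem exists_fixed_le (hF : IsDeg2Map F) {a x : ℝ} (ha : F a = a) (hx : x ≤ F x) :
    ∃ p, p ≤ x ∧ F p = p := by
  obtain ⟨p, hp, h⟩ := hF.reflect.exists_fixed_ge (a := -a) (x := -x) (by simp [ha])
    (by simpa using hx)
  exact ⟨-p, by linarith, by linarith⟩

theorem isCompact_fixed (hF : IsDeg2Map F) {a : ℝ} (ha : F a = a) :
    IsCompact {x | F x = x} := by
  refine isCompact_Icc.of_isClosed_subset (isClosed_eq hF.continuous continuous_id)
    (fun x (hx : F x = x) => (⟨?_, ?_⟩ : x ∈ Icc (a - 1) (a + 1)))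
  · by_contra! h
    linarith [hF.map_lt_of_le_sub_one ha h.le]
  · by_contra! h
    linarith [hF.lt_map_of_add_one_le ha h.le]

/-- Iterates of a translate `a + k` of a fixed point `a` stay among such translates. -/
theorem iterate_add_int (hF : IsDeg2Map F) {a : ℝ} (ha : F a = a) (m : ℕ) (k : ℤ) :
    ∃ l : ℤ, F^[m] (a + k) = a + l := by
  induction m generalizing k with
  | zero => exact ⟨k, rfl⟩
  | succ m ih =>
    obtain ⟨l, hl⟩ := ih (2 * k)
    refine ⟨l, ?_⟩
    rw [Function.iterate_succ_apply, hF.map_add_int, ha, ← hl]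
    push_cast
    rfl

theorem add_int_notMem_Ioo {a y : ℝ} (hy : y < a + 1) (l k : ℤ) :
    a + (l : ℝ) ∉ Ioo (a + (k : ℝ)) (y + k) := by
  rintro ⟨h1, h2⟩
  have h3 : k < l := by exact_mod_cast (by linarith : (k : ℝ) < l)
  have h4 : l < k + 1 := by exact_mod_cast (by linarith : (l : ℝ) < k + 1)
  omega

/-- If `a` is the only fixed point of `F`, then points just above `a` can be found whose orbit,
like that of `a`, avoids every integer translate of the interval between them and `a`. -/
theorem exists_avoiding_right (hF : IsDeg2Map F) {a : ℝ} (ha : F a = a)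
    (huniq : ∀ p, F p = p → p = a) {δ : ℝ} (hδ : 0 < δ) :
    ∃ y, a < y ∧ y < a + δ ∧ y < a + 1 ∧
      ∀ (n : ℕ) (k : ℤ), F^[n] a ∉ Ioo (a + (k : ℝ)) (y + k) ∧
        F^[n] y ∉ Ioo (a + (k : ℝ)) (y + k) := by
  have hlt : ∀ x, a < x → x < F x := by
    intro x hx
    by_contra! h
    obtain ⟨p, hp, hfp⟩ := hF.exists_fixed_ge ha h
    linarith [huniq p hfp]
  set x := a + min δ 1 / 2 with hxdef
  have hmin : 0 < min δ 1 := lt_min hδ one_pos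
  have hax : a < x := by linarith
  have hxδ : x < a + δ := by linarith [min_le_left δ 1]
  have hx1 : x < a + 1 := by linarith [min_le_right δ 1]
  obtain ⟨n, hn⟩ : ∃ n, a + 1 ≤ F^[n] x := by
    by_contra! hbdd
    have hmono := hF.strictMono.monotone.monotone_iterate_of_le_map (hlt x hax).le
    have hb : BddAbove (range fun n => F^[n] x) := ⟨a + 1, by
      rintro _ ⟨n, rfl⟩
      exact (hbdd n).le⟩
    have hlim := tendsto_atTop_ciSup hmono hb
    have hfp := huniq _ (isFixedPt_of_tendsto_iterate hlim hF.continuous.continuousAt)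
    have h0 : x ≤ ⨆ n, F^[n] x := le_ciSup hb 0
    linarith
  have hfixa : ∀ n, F^[n] a = a := fun n => Function.iterate_fixed ha n
  obtain ⟨y, ⟨hay, hyx⟩, hy⟩ := intermediate_value_Icc hax.le
    (hF.continuous.iterate n).continuousOn
    (show a + 1 ∈ Icc _ _ from ⟨by rw [hfixa]; linarith, hn⟩)
  have hay : a < y := by
    refine lt_of_le_of_ne hay ?_
    rintro rfl
    rw [hfixa] at hy
    linarith
  have hy1 : y < a + 1 := by linarith
  refine ⟨y, hay, by linarith, hy1, fun m k => ⟨?_, ?_⟩⟩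
  · simpa [hfixa] using add_int_notMem_Ioo hy1 0 k
  · have hmono := hF.strictMono.monotone.monotone_iterate_of_le_map (hlt y hay).le
    rcases le_total m n with hmn | hnm
    · have h0 : y ≤ F^[m] y := hmono (Nat.zero_le m)
      have h1 : F^[m] y ≤ a + 1 := (hmono hmn).trans_eq hy
      rintro ⟨h2, h3⟩
      have h4 : (0 : ℤ) < k := by exact_mod_cast (by linarith : (0 : ℝ) < k)
      have h5 : k < 1 := by exact_mod_cast (by linarith : (k : ℝ) < 1)
      omega
    · obtain ⟨l, hl⟩ := hF.iterate_add_int ha (m - n) 1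
      have : F^[m] y = a + l := by
        rw [← hl, Int.cast_one, ← hy, ← Function.iterate_add_apply, Nat.sub_add_cancel hnm]
      rw [this]
      exact add_int_notMem_Ioo hy1 l k

theorem exists_avoiding_left (hF : IsDeg2Map F) {a : ℝ} (ha : F a = a)
    (huniq : ∀ p, F p = p → p = a) {δ : ℝ} (hδ : 0 < δ) :
    ∃ y, y < a ∧ a - δ < y ∧ a - 1 < y ∧
      ∀ (n : ℕ) (k : ℤ), F^[n] y ∉ Ioo (y + (k : ℝ)) (a + k) ∧
        F^[n] a ∉ Ioo (y + (k : ℝ)) (a + k) := by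
  obtain ⟨y, h1, h2, h3, h4⟩ := hF.reflect.exists_avoiding_right (a := -a) (by simp [ha])
    (fun p hp => by linarith [huniq (-p) (by linarith)]) hδ
  have hiter : ∀ n x, (fun x => -F (-x))^[n] x = -F^[n] (-x) := by
    intro n x
    have : Function.Semiconj (fun x : ℝ => -x) (fun x => -F (-x)) F := fun x => by simp
    rw [← (this.iterate_right n).eq x, neg_neg]
  refine ⟨-y, by linarith, by linarith, by linarith, fun n k => ?_⟩
  obtain ⟨hna, hny⟩ := h4 n (-k)
  rw [hiter] at hna hny
  rw [neg_neg] at hna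
  push_cast at hna hny
  exact ⟨fun h => hny ⟨by linarith [h.2], by linarith [h.1]⟩,
    fun h => hna ⟨by linarith [h.2], by linarith [h.1]⟩⟩

end IsDeg2Map

theorem UnitAddCircle.coe_eq_coe_iff {x y : ℝ} :
    (x : UnitAddCircle) = y ↔ ∃ k : ℤ, x = y + k := by
  rw [← sub_eq_zero, ← AddCircle.coe_sub, AddCircle.coe_eq_zero_iff]
  constructor
  · rintro ⟨k, hk⟩
    exact ⟨k, by simp at hk; linarith⟩
  · rintro ⟨k, hk⟩
    exact ⟨k, by simp; linarith⟩

theorem mem_closedArc_iff {a ℓ x : ℝ} :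
    (x : UnitAddCircle) ∈ closedArc a ℓ ↔ ∃ k : ℤ, x ∈ Icc (a + (k : ℝ)) (a + ℓ + k) := by
  constructor
  · rintro ⟨t, ⟨h1, h2⟩, ht⟩
    obtain ⟨k, hk⟩ := UnitAddCircle.coe_eq_coe_iff.1 ht.symm
    exact ⟨k, by linarith, by linarith⟩
  · rintro ⟨k, h1, h2⟩
    exact ⟨x - k, ⟨by linarith, by linarith⟩,
      UnitAddCircle.coe_eq_coe_iff.2 ⟨-k, by push_cast; ring⟩⟩

theorem mem_openArc_iff {a ℓ x : ℝ} :
    (x : UnitAddCircle) ∈ openArc a ℓ ↔ ∃ k : ℤ, x ∈ Ioo (a + (k : ℝ)) (a + ℓ + k) := by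
  constructor
  · rintro ⟨t, ⟨h1, h2⟩, ht⟩
    obtain ⟨k, hk⟩ := UnitAddCircle.coe_eq_coe_iff.1 ht.symm
    exact ⟨k, by linarith, by linarith⟩
  · rintro ⟨k, h1, h2⟩
    exact ⟨x - k, ⟨by linarith, by linarith⟩,
      UnitAddCircle.coe_eq_coe_iff.2 ⟨-k, by push_cast; ring⟩⟩

theorem isClosed_closedArc (a ℓ : ℝ) : IsClosed (closedArc a ℓ) :=
  (isCompact_Icc.image (AddCircle.continuous_mk' 1)).isClosed

theorem isOpen_openArc (a ℓ : ℝ) : IsOpen (openArc a ℓ) :=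
  QuotientAddGroup.isOpenMap_coe _ isOpen_Ioo

theorem frontier_closedArc_subset (a ℓ : ℝ) :
    frontier (closedArc a ℓ) ⊆ {(a : UnitAddCircle), ((a + ℓ : ℝ) : UnitAddCircle)} := by
  intro z hz
  rw [(isClosed_closedArc a ℓ).frontier_eq] at hz
  obtain ⟨⟨t, ht, rfl⟩, hz⟩ := hz
  have hsub : openArc a ℓ ⊆ interior (closedArc a ℓ) :=
    interior_maximal (image_mono Ioo_subset_Icc_self) (isOpen_openArc a ℓ)
  rcases eq_or_lt_of_le ht.1 with h1 | h1
  · left; rw [h1]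
  rcases eq_or_lt_of_le ht.2 with h2 | h2
  · right; rw [← h2]; rfl
  exact absurd (hsub ⟨t, ⟨h1, h2⟩, rfl⟩) hz

theorem interior_closedArc_subset {a ℓ : ℝ} (hℓ : ℓ < 1) :
    interior (closedArc a ℓ) ⊆ openArc a ℓ := by
  intro z hz
  obtain ⟨t, ⟨h1, h2⟩, rfl⟩ := interior_subset hz
  have hopen : IsOpen ((fun t : ℝ => (t : UnitAddCircle)) ⁻¹' interior (closedArc a ℓ)) :=
    isOpen_interior.preimage (AddCircle.continuous_mk' 1)
  obtain ⟨ε, hε, hball⟩ := Metric.isOpen_iff.1 hopen t hz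
  set η := min (ε / 2) ((1 - ℓ) / 2) with hη
  have hη0 : 0 < η := lt_min (by linarith) (by linarith)
  have hηε : η < ε := (min_le_left _ _).trans_lt (by linarith)
  have hηℓ : η < 1 - ℓ := (min_le_right _ _).trans_lt (by linarith)
  have key : ∀ s : ℝ, |s - t| < ε → ∃ k : ℤ, s ∈ Icc (a + (k : ℝ)) (a + ℓ + k) := fun s hs =>
    mem_closedArc_iff.1 (interior_subset (hball (by rwa [Metric.mem_ball, Real.dist_eq])))
  refine ⟨t, ⟨lt_of_le_of_ne h1 ?_, lt_of_le_of_ne h2 ?_⟩, rfl⟩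
  · intro h
    obtain ⟨k, hk1, hk2⟩ := key (t - η) (by rw [abs_lt]; constructor <;> linarith)
    have h4 : k < 0 := by exact_mod_cast (by linarith : (k : ℝ) < 0)
    have h5 : -1 < k := by exact_mod_cast (by linarith : (-1 : ℝ) < k)
    omega
  · intro h
    obtain ⟨k, hk1, hk2⟩ := key (t + η) (by rw [abs_lt]; constructor <;> linarith)
    have h4 : k < 1 := by exact_mod_cast (by linarith : (k : ℝ) < 1)
    have h5 : 0 < k := by exact_mod_cast (by linarith : (0 : ℝ) < k)
    omega

namespace IsLiftDeg2

variable {φ : UnitAddCircle → UnitAddCircle} {F : ℝ → ℝ}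

theorem isDeg2Map (hF : IsLiftDeg2 φ F) : IsDeg2Map F := ⟨hF.1, hF.2.1, hF.2.2.1⟩

theorem iterate_coe (hF : IsLiftDeg2 φ F) (n : ℕ) (x : ℝ) :
    φ^[n] (x : UnitAddCircle) = ((F^[n] x : ℝ) : UnitAddCircle) := by
  have : Function.Semiconj (fun t : ℝ => (t : UnitAddCircle)) F φ := fun x => (hF.2.2.2 x).symm
  exact ((this.iterate_right n).eq x).symm

theorem isNice_closedArc (hF : IsLiftDeg2 φ F) {a ℓ : ℝ} (hℓ : ℓ < 1)
    (h : ∀ (n : ℕ) (k : ℤ), F^[n] a ∉ Ioo (a + (k : ℝ)) (a + ℓ + k) ∧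
      F^[n] (a + ℓ) ∉ Ioo (a + (k : ℝ)) (a + ℓ + k)) :
    IsNice φ (closedArc a ℓ) := by
  intro n _
  rw [eq_empty_iff_forall_notMem]
  rintro _ ⟨⟨z, hz, rfl⟩, hint⟩
  have hop := interior_closedArc_subset hℓ hint
  rcases frontier_closedArc_subset a ℓ hz with rfl | rfl
  · rw [hF.iterate_coe, mem_openArc_iff] at hop
    obtain ⟨k, hk⟩ := hop
    exact (h n k).1 hk
  · rw [hF.iterate_coe, mem_openArc_iff] at hop
    obtain ⟨k, hk⟩ := hop
    exact (h n k).2 hk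

/-- A lifted arc mapped into itself on the circle and containing the fixed point `a` of the lift
is mapped into itself by the lift. -/
theorem mapsTo_Icc (hF : IsLiftDeg2 φ F) {a b ℓ : ℝ} (ha : F a = a) (hℓ : ℓ < 1)
    (hab : a ∈ Icc b (b + ℓ)) {s : ℕ}
    (hmaps : MapsTo (φ^[s]) (closedArc b ℓ) (closedArc b ℓ)) :
    MapsTo (F^[s]) (Icc b (b + ℓ)) (Icc b (b + ℓ)) := by
  have hcont : Continuous (F^[s]) := hF.1.iterate s
  have hfa : F^[s] a = a := Function.iterate_fixed ha s
  have hord : (F^[s] '' Icc b (b + ℓ)).OrdConnected :=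
    (isPreconnected_Icc.image _ hcont.continuousOn).ordConnected
  have hcover : ∀ x ∈ F^[s] '' Icc b (b + ℓ),
      ∃ k : ℤ, x ∈ Icc (b + (k : ℝ)) (b + ℓ + k) := by
    rintro _ ⟨x, hx, rfl⟩
    rw [← mem_closedArc_iff, ← hF.iterate_coe]
    exact hmaps ⟨x, hx, rfl⟩
  have hamem : a ∈ F^[s] '' Icc b (b + ℓ) := ⟨a, hab, hfa⟩
  intro x hx
  have hxmem := mem_image_of_mem (F^[s]) hx
  constructor
  · by_contra! hlt
    -- a point in the gap just below `b`
    obtain ⟨c, hc1, hc2⟩ := exists_between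
      (max_lt hlt (by linarith : b + ℓ - 1 < b))
    obtain ⟨hc3, hc4⟩ := max_lt_iff.1 hc1
    obtain ⟨k, hk1, hk2⟩ := hcover c
      (hord.out hxmem hamem ⟨hc3.le, by linarith [hab.1]⟩)
    have h4 : k < 0 := by exact_mod_cast (by linarith : (k : ℝ) < 0)
    have h5 : -1 < k := by exact_mod_cast (by linarith : (-1 : ℝ) < k)
    omega
  · by_contra! hlt
    obtain ⟨c, hc1, hc2⟩ := exists_between
      (lt_min hlt (by linarith : b + ℓ < b + 1))
    obtain ⟨hc3, hc4⟩ := lt_min_iff.1 hc2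
    obtain ⟨k, hk1, hk2⟩ := hcover c
      (hord.out hamem hxmem ⟨by linarith [hab.2], hc3.le⟩)
    have h4 : k < 1 := by exact_mod_cast (by linarith : (k : ℝ) < 1)
    have h5 : 0 < k := by exact_mod_cast (by linarith : (0 : ℝ) < k)
    omega

theorem isPeriodicInterval_one (hF : IsLiftDeg2 φ F) {q ℓ : ℝ} (hq : F q = q)
    (hp : F (q + ℓ) = q + ℓ) (h0 : 0 < ℓ) (h1 : ℓ < 1) :
    IsPeriodicInterval φ 1 (closedArc q ℓ) := by
  refine ⟨le_rfl, ⟨q, ℓ, h0, h1, rfl⟩, ?_⟩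
  have hbij : BijOn F (Icc q (q + ℓ)) (Icc q (q + ℓ)) := by
    refine ⟨fun x hx => ⟨?_, ?_⟩, hF.2.1.injective.injOn, ?_⟩
    · simpa only [hq] using hF.2.1.monotone hx.1
    · simpa only [hp] using hF.2.1.monotone hx.2
    · have := intermediate_value_Icc (by linarith : q ≤ q + ℓ) hF.1.continuousOn
      rwa [hq, hp] at this
  have hinj : InjOn (fun t : ℝ => (t : UnitAddCircle)) (Icc q (q + ℓ)) := by
    intro x hx y hy hxy
    obtain ⟨k, hk⟩ := UnitAddCircle.coe_eq_coe_iff.1 hxy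
    have h4 : k < 1 := by exact_mod_cast (by linarith [hx.2, hy.1] : (k : ℝ) < 1)
    have h5 : -1 < k := by exact_mod_cast (by linarith [hx.1, hy.2] : (-1 : ℝ) < k)
    obtain rfl : k = 0 := by omega
    simpa using hk
  rw [Function.iterate_one]
  refine ⟨?_, ?_, ?_⟩
  · rintro _ ⟨x, hx, rfl⟩
    exact ⟨F x, hbij.mapsTo hx, (hF.2.2.2 x).symm⟩
  · rintro _ ⟨x, hx, rfl⟩ _ ⟨y, hy, rfl⟩ hxy
    simp only [hF.2.2.2] at hxy
    rw [hbij.injOn hx hy (hinj (hbij.mapsTo hx) (hbij.mapsTo hy) hxy)]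
  · rintro _ ⟨y, hy, rfl⟩
    obtain ⟨x, hx, rfl⟩ := hbij.surjOn hy
    exact ⟨x, ⟨x, hx, rfl⟩, hF.2.2.2 x⟩

/-- If the lift has two distinct fixed points, these lie in a maximal periodic interval. -/
theorem exists_isMaxPeriodicInterval (hF : IsLiftDeg2 φ F) {a p : ℝ} (ha : F a = a)
    (hp : F p = p) (hne : p ≠ a) :
    ∃ I, IsMaxPeriodicInterval φ I ∧ (a : UnitAddCircle) ∈ I := by
  have hF' := hF.isDeg2Map
  have hcpt := hF'.isCompact_fixed ha
  obtain ⟨r, hr, hrmax⟩ := hcpt.exists_isGreatest ⟨a, ha⟩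
  obtain ⟨q, hq, hqmin⟩ := hcpt.exists_isLeast ⟨a, ha⟩
  rw [mem_ofPred_eq] at hr hq
  have hqr : q < r := by
    rcases lt_or_gt_of_ne hne with h | h
    · exact (hqmin hp).trans_lt (h.trans_le (hrmax ha))
    · exact (hqmin ha).trans_lt (h.trans_le (hrmax hp))
  have hr1 : r < q + 1 := by
    by_contra! h
    linarith [hF'.lt_map_of_add_one_le hq h]
  obtain ⟨ℓ, rfl⟩ : ∃ ℓ, r = q + ℓ := ⟨r - q, by ring⟩
  have haI : (a : UnitAddCircle) ∈ closedArc q ℓ := ⟨a, ⟨hqmin ha, hrmax ha⟩, rfl⟩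
  refine ⟨closedArc q ℓ, ⟨⟨1, hF.isPeriodicInterval_one hq hr (by linarith) (by linarith)⟩,
    fun J hJ hIJ => hIJ.antisymm ?_⟩, haI⟩
  obtain ⟨s, hs, ⟨b, m, hm0, hm1, rfl⟩, hbij⟩ := hJ
  obtain ⟨k, hk⟩ := mem_closedArc_iff.1 (hIJ haI)
  have hshift : closedArc b m = closedArc (b + k) m := by
    ext z
    obtain ⟨x, rfl⟩ := QuotientAddGroup.mk_surjective z
    change (x : UnitAddCircle) ∈ _ ↔ (x : UnitAddCircle) ∈ _
    rw [mem_closedArc_iff, mem_closedArc_iff]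
    constructor
    · rintro ⟨j, h1, h2⟩
      exact ⟨j - k, by push_cast; linarith, by push_cast; linarith⟩
    · rintro ⟨j, h1, h2⟩
      exact ⟨j + k, by push_cast; linarith, by push_cast; linarith⟩
  rw [hshift] at hbij ⊢
  set c := b + (k : ℝ) with hc
  have hmaps := hF.mapsTo_Icc ha hm1 (b := c) ⟨hk.1, by linarith [hk.2]⟩ hbij.mapsTo
  have hle_of_iter : ∀ x, F^[s] x ≤ x → F x ≤ x := by
    intro x hx
    by_contra! h
    have := hF.2.1.strictMono_iterate_of_lt_map h (show 0 < s by omega)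
    exact absurd hx (not_le.2 this)
  have hge_of_iter : ∀ x, x ≤ F^[s] x → x ≤ F x := by
    intro x hx
    by_contra! h
    have := hF.2.1.strictAnti_iterate_of_map_lt h (show 0 < s by omega)
    exact absurd hx (not_le.2 this)
  obtain ⟨u, hu, hfu⟩ := hF'.exists_fixed_ge ha
    (hle_of_iter _ (hmaps (right_mem_Icc.2 (by linarith))).2)
  obtain ⟨v, hv, hfv⟩ := hF'.exists_fixed_le ha
    (hge_of_iter _ (hmaps (left_mem_Icc.2 (by linarith))).1)
  exact image_mono (Icc_subset_Icc ((hqmin hfv).trans hv) (hu.trans (hrmax hfu)))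

/-- The lift has a unique fixed point above each fixed point of `φ` in `Λ`. -/
theorem exists_unique_fixed_lift (hF : IsLiftDeg2 φ F) {x₀ : UnitAddCircle}
    (hx₀ : x₀ ∈ lambdaSet φ) (hfix : φ x₀ = x₀) :
    ∃ a : ℝ, x₀ = (a : UnitAddCircle) ∧ F a = a ∧ ∀ p, F p = p → p = a := by
  obtain ⟨t, rfl⟩ := QuotientAddGroup.mk_surjective x₀
  change φ (t : UnitAddCircle) = (t : UnitAddCircle) at hfix
  rw [hF.2.2.2] at hfix
  obtain ⟨k, hk⟩ := UnitAddCircle.coe_eq_coe_iff.1 hfix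
  have hta : (t : UnitAddCircle) = ((t + (-k : ℤ) : ℝ) : UnitAddCircle) :=
    UnitAddCircle.coe_eq_coe_iff.2 ⟨k, by push_cast; ring⟩
  have ha : F (t + (-k : ℤ)) = t + (-k : ℤ) := by
    rw [hF.isDeg2Map.map_add_int, hk]; push_cast; ring
  refine ⟨_, hta, ha, fun p hp => ?_⟩
  by_contra hne
  obtain ⟨I, hI, haI⟩ := hF.exists_isMaxPeriodicInterval ha hp hne
  exact hx₀.2 (mem_iUnion.2 ⟨0, mem_iUnion₂.2 ⟨I, hI, hta ▸ haI⟩⟩)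

end IsLiftDeg2

/-- Lemma on nice intervals: if `x₀ ∈ Λ` is a fixed point accumulated by
`Λ` from the right, there exist arbitrarily small nice intervals with left endpoint `x₀`;
symmetrically on the left. -/
theorem exists_small_nice_interval
    (φ : UnitAddCircle → UnitAddCircle) (F : ℝ → ℝ)
    (hF : IsLiftDeg2 φ F)
    (hnc : ¬ ConjugateToDoubling φ)
    (hfin : {I | IsMaxPeriodicInterval φ I}.Finite)
    (hne : {I | IsMaxPeriodicInterval φ I}.Nonempty)
    (x₀ : UnitAddCircle) (hx₀ : x₀ ∈ lambdaSet φ) (hfix : φ x₀ = x₀) :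
    ((∀ ε : ℝ, 0 < ε → (rightArc x₀ ε ∩ lambdaSet φ).Nonempty) →
      ∀ δ : ℝ, 0 < δ → ∃ a ℓ : ℝ, 0 < ℓ ∧ ℓ < δ ∧ ℓ < 1 ∧
        x₀ = (a : UnitAddCircle) ∧ IsNice φ (closedArc a ℓ)) ∧
    ((∀ ε : ℝ, 0 < ε → (leftArc x₀ ε ∩ lambdaSet φ).Nonempty) →
      ∀ δ : ℝ, 0 < δ → ∃ a ℓ : ℝ, 0 < ℓ ∧ ℓ < δ ∧ ℓ < 1 ∧
        x₀ = ((a + ℓ : ℝ) : UnitAddCircle) ∧ IsNice φ (closedArc a ℓ)) := by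
  obtain ⟨a, rfl, ha, huniq⟩ := hF.exists_unique_fixed_lift hx₀ hfix
  refine ⟨fun _ δ hδ => ?_, fun _ δ hδ => ?_⟩
  · obtain ⟨y, h1, h2, h3, h4⟩ := hF.isDeg2Map.exists_avoiding_right ha huniq hδ
    refine ⟨a, y - a, by linarith, by linarith, by linarith, rfl,
      hF.isNice_closedArc (by linarith) ?_⟩
    simpa only [add_sub_cancel] using h4
  · obtain ⟨y, h1, h2, h3, h4⟩ := hF.isDeg2Map.exists_avoiding_left ha huniq hδ
    refine ⟨y, a - y, by linarith, by linarith, by linarith, by rw [add_sub_cancel],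
      hF.isNice_closedArc (by linarith) ?_⟩
    simpa only [add_sub_cancel] using h4
end
end

section
/- Let φ be a circle covering map of degree two of class C² with positive derivative. Then there exists a constant C₀ > 0 such that for every proper closed arc J ⊂ 𝕊¹ and every n ≥ 1 for which the arcs J, φ(J), …, φ^{n-1}(J) are pairwise disjoint, the distortion of φⁿ on J satisfies χ(φⁿ, J) ≤ C₀. -/
open Set Filter MeasureTheory Topology

noncomputable section

/-- A continuously differentiable periodic function on `ℝ` is globally Lipschitz. -/
lemma Function.Periodic.exists_abs_sub_le {G : ℝ → ℝ} (hG : Function.Periodic G 1)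
    (hC1 : ContDiff ℝ 1 G) : ∃ K : ℝ, 0 ≤ K ∧ ∀ x y, |G x - G y| ≤ K * |x - y| := by
  have hper : Function.Periodic (deriv G) 1 := fun x => by
    rw [← deriv_comp_add_const, funext hG]
  obtain ⟨K, hK⟩ := isCompact_Icc.exists_bound_of_continuousOn (s := Icc (0 : ℝ) 1)
    (hC1.continuous_deriv le_rfl).continuousOn
  have hbound : ∀ x, ‖deriv G x‖ ≤ K := fun x => by
    obtain ⟨y, hy, hxy⟩ := hper.exists_mem_Ico₀ one_pos x
    exact hxy ▸ hK y (Ico_subset_Icc_self hy)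
  refine ⟨K, (norm_nonneg _).trans (hbound 0), fun x y => ?_⟩
  exact convex_univ.norm_image_sub_le_of_norm_deriv_le
    (fun z _ => (hC1.differentiable one_ne_zero).differentiableAt) (fun z _ => hbound z)
    (mem_univ y) (mem_univ x)

/-- Chain rule for iterates, in logarithmic form. -/
lemma log_deriv_iterate {F : ℝ → ℝ} (hF : Differentiable ℝ F) (hpos : ∀ x, 0 < deriv F x)
    (n : ℕ) (x : ℝ) : 0 < deriv (F^[n]) x ∧
      Real.log (deriv (F^[n]) x) = ∑ i ∈ Finset.range n, Real.log (deriv F (F^[i] x)) := by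
  induction n with
  | zero => simp
  | succ n ih =>
    have h : deriv (F^[n + 1]) x = deriv F (F^[n] x) * deriv (F^[n]) x := by
      rw [Function.iterate_succ', deriv_comp x (hF _) (hF.iterate n x)]
    rw [h, Real.log_mul (hpos _).ne' ih.1.ne', ih.2, Finset.sum_range_succ, add_comm]
    exact ⟨mul_pos (hpos _) ih.1, rfl⟩

lemma closedBall_subset_image_Icc (u v : ℝ) :
    Metric.closedBall (((u + v) / 2 : ℝ) : UnitAddCircle) ((v - u) / 2) ⊆
      (fun t : ℝ => (t : UnitAddCircle)) '' Icc u v := by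
  intro w hw
  obtain ⟨t, rfl⟩ := QuotientAddGroup.mk_surjective w
  have ht : t ∈ (fun t : ℝ => (t : UnitAddCircle)) ⁻¹'
      Metric.closedBall (((u + v) / 2 : ℝ) : UnitAddCircle) ((v - u) / 2) := hw
  rw [AddCircle.coe_real_preimage_closedBall_eq_iUnion, mem_iUnion] at ht
  obtain ⟨k, hk⟩ := ht
  rw [Metric.mem_closedBall, Real.dist_eq, abs_le] at hk
  simp only [zsmul_eq_mul, mul_one] at hk
  refine ⟨t - k, ⟨by linarith, by linarith⟩, ?_⟩
  have hzero : ((k : ℝ) : UnitAddCircle) = 0 :=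
    AddCircle.coe_eq_zero_iff 1 |>.2 ⟨k, by simp⟩
  simp only [AddCircle.coe_sub, hzero, sub_zero]

/-- Pairwise disjoint arcs of the circle have total length at most one. -/
lemma sum_min_length_le_one {n : ℕ} {u v : ℕ → ℝ} (huv : ∀ i, u i ≤ v i)
    (hdisj : ∀ i j, i < n → j < n → i ≠ j →
      Disjoint ((fun t : ℝ => (t : UnitAddCircle)) '' Icc (u i) (v i))
        ((fun t : ℝ => (t : UnitAddCircle)) '' Icc (u j) (v j))) :
    ∑ i ∈ Finset.range n, min 1 (v i - u i) ≤ 1 := by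
  let B : ℕ → Set UnitAddCircle := fun i =>
    Metric.closedBall (((u i + v i) / 2 : ℝ) : UnitAddCircle) ((v i - u i) / 2)
  have hsum := sum_measure_le_measure_univ (μ := (volume : Measure UnitAddCircle))
    (s := Finset.range n) (t := B)
    (fun i _ => Metric.isClosed_closedBall.measurableSet.nullMeasurableSet)
    (fun i hi j hj hij => (Disjoint.mono (closedBall_subset_image_Icc _ _)
      (closedBall_subset_image_Icc _ _) (hdisj i j (by simpa using hi) (by simpa using hj)
        hij)).aedisjoint)
  have hvol : ∀ i, volume (B i) = ENNReal.ofReal (min 1 (v i - u i)) := fun i => by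
    rw [AddCircle.volume_closedBall, mul_div_cancel₀ _ two_ne_zero]
  simp only [hvol, UnitAddCircle.measure_univ] at hsum
  rwa [← ENNReal.ofReal_sum_of_nonneg
    (fun i _ => le_min zero_le_one (sub_nonneg.2 (huv i))), ENNReal.ofReal_le_one] at hsum

/-- bounded distortion: there is `C₀ > 0` bounding the distortion
`χ(φⁿ, J) = sup_{x,y ∈ J} log((φⁿ)′(x)/(φⁿ)′(y))` over all arcs `J` whose first `n`
iterates are pairwise disjoint. Derivatives are computed via the lift `F`. -/
theorem bounded_distortion
    (φ : UnitAddCircle → UnitAddCircle) (F : ℝ → ℝ)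
    (hF : IsLiftDeg2 φ F) (hC2 : ContDiff ℝ 2 F) (hpos : ∀ x : ℝ, 0 < deriv F x) :
    ∃ C₀ : ℝ, 0 < C₀ ∧ ∀ (a ℓ : ℝ) (n : ℕ), 0 < ℓ → ℓ < 1 → 1 ≤ n →
      (∀ i j : ℕ, i < n → j < n → i ≠ j →
        (φ^[i]) '' closedArc a ℓ ∩ (φ^[j]) '' closedArc a ℓ = ∅) →
      ∀ x ∈ Set.Icc a (a + ℓ), ∀ y ∈ Set.Icc a (a + ℓ),
        Real.log (deriv (F^[n]) x / deriv (F^[n]) y) ≤ C₀ := by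
  obtain ⟨hcont, hmono, htrans, hlift⟩ := hF
  have hC1 : ContDiff ℝ 1 (deriv F) := ContDiff.deriv' hC2
  have hper : Function.Periodic (fun x => Real.log (deriv F x)) 1 := fun x => by
    have : deriv F (x + 1) = deriv F x := by
      rw [← deriv_comp_add_const, funext htrans, deriv_add_const]
    simp only [this]
  obtain ⟨K, hK0, hK⟩ := hper.exists_abs_sub_le (hC1.log fun x => (hpos x).ne')
  refine ⟨K + 1, by linarith, fun a ℓ n hℓ0 hℓ1 hn hdisj x hx y hy => ?_⟩
  have hiter : ∀ (i : ℕ) (t : ℝ), φ^[i] (t : UnitAddCircle) = ((F^[i] t : ℝ) : UnitAddCircle) :=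
    fun i t => ((Function.Semiconj.iterate_right (f := fun t : ℝ => (t : UnitAddCircle))
      (fun t => (hlift t).symm) i) t).symm
  have harc : ∀ i, (fun t : ℝ => (t : UnitAddCircle)) '' Icc (F^[i] a) (F^[i] (a + ℓ)) ⊆
      φ^[i] '' closedArc a ℓ := by
    rintro i _ ⟨s, hs, rfl⟩
    obtain ⟨t, ht, rfl⟩ := intermediate_value_Icc (by linarith : a ≤ a + ℓ)
      (hcont.iterate i).continuousOn hs
    exact ⟨_, ⟨t, ht, rfl⟩, hiter i t⟩
  have hlt : ∀ i, F^[i] a < F^[i] (a + ℓ) := fun i => hmono.iterate i (by linarith)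
  have hmin := sum_min_length_le_one (n := n) (fun i => (hlt i).le) fun i j hi hj hij =>
    (disjoint_iff_inter_eq_empty.2 (hdisj i j hi hj hij)).mono (harc i) (harc j)
  have hminpos : ∀ i, 0 < min 1 (F^[i] (a + ℓ) - F^[i] a) :=
    fun i => lt_min one_pos (sub_pos.2 (hlt i))
  have hlen : ∀ i ∈ Finset.range n, F^[i] (a + ℓ) - F^[i] a ≤ 1 := by
    intro i hi
    by_contra! hlong
    have hone : min 1 (F^[i] (a + ℓ) - F^[i] a) = 1 := min_eq_left hlong.le
    have hi0 : i ≠ 0 := by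
      rintro rfl
      simp only [Function.iterate_zero, id_eq] at hlong
      linarith
    have hpair := Finset.add_le_sum (fun j _ => (hminpos j).le) hi
      (Finset.mem_range.2 hn) hi0
    linarith [hminpos 0]
  have hdist : ∀ i, |F^[i] x - F^[i] y| ≤ F^[i] (a + ℓ) - F^[i] a := fun i => by
    have hm := (hmono.iterate i).monotone
    have := hm hx.1; have := hm hx.2; have := hm hy.1; have := hm hy.2
    rw [abs_le]
    constructor <;> linarith
  obtain ⟨hx0, hxlog⟩ := log_deriv_iterate (hC2.differentiable two_ne_zero) hpos n x
  obtain ⟨hy0, hylog⟩ := log_deriv_iterate (hC2.differentiable two_ne_zero) hpos n y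
  rw [Real.log_div hx0.ne' hy0.ne', hxlog, hylog, ← Finset.sum_sub_distrib]
  calc ∑ i ∈ Finset.range n, (Real.log (deriv F (F^[i] x)) - Real.log (deriv F (F^[i] y)))
      ≤ ∑ i ∈ Finset.range n, K * min 1 (F^[i] (a + ℓ) - F^[i] a) := by
        refine Finset.sum_le_sum fun i hi => ?_
        rw [min_eq_right (hlen i hi)]
        exact (le_abs_self _).trans
          ((hK _ _).trans (mul_le_mul_of_nonneg_left (hdist i) hK0))
    _ = K * ∑ i ∈ Finset.range n, min 1 (F^[i] (a + ℓ) - F^[i] a) := by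
        rw [Finset.mul_sum]
    _ ≤ K * 1 := mul_le_mul_of_nonneg_left hmin hK0
    _ ≤ K + 1 := by linarith
end
end

section
/- Let φ be a circle covering map of degree two of class C² with positive derivative, not topologically conjugate to the doubling map, such that the collection of all maximal periodic intervals of φ is finite and nonempty, say I₁,…,I_r, and set Λ := 𝕊¹ \ ⋃_{n≥0} φ^{-n}(I₁ ∪ ⋯ ∪ I_r). Let x₀ be a fixed point of φ such that (x₀, x₀+ε) ∩ Λ ≠ ∅ for every ε > 0. Then for every K ≥ 1 there exists ε > 0 such that: whenever p ∈ Λ is a periodic point of φ of period s with φ^i(p) ∈ (x₀, x₀+ε) for some i ∈ {0, 1, …, s−1}, one has (φ^s)′(p) ≥ K. The symmetric statement holds when (x₀−ε, x₀) ∩ Λ ≠ ∅ for every ε > 0. -/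
open Set Filter MeasureTheory Topology

noncomputable section

/-! ### Degree-two lifts and their iterates -/

theorem lift_iterate_add_int {F : ℝ → ℝ} (hF : ∀ x, F (x + 1) = F x + 2) (n : ℕ) (x : ℝ) (m : ℤ) :
    F^[n] (x + m) = F^[n] x + 2 ^ n * m := by
  have h1 : ∀ (x : ℝ) (m : ℤ), F (x + m) = F x + 2 * m := by
    intro x m
    induction m using Int.induction_on with
    | zero => simp
    | succ k ih =>
      have := hF (x + (k : ℤ))
      push_cast at *
      rw [← add_assoc, this, ih]; ring
    | pred k ih =>
      have := hF (x + ((-k - 1 : ℤ) : ℝ))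
      push_cast at *
      rw [show x + (-(k : ℝ) - 1) + 1 = x + -k by ring] at this
      linarith
  induction n generalizing x m with
  | zero => simp
  | succ k ih =>
    have h2 := ih (F x) (2 * m)
    push_cast at h2
    rw [Function.iterate_succ_apply, Function.iterate_succ_apply, h1, h2]; ring

theorem lift_iterate_coe {φ : UnitAddCircle → UnitAddCircle} {F : ℝ → ℝ}
    (hφ : ∀ x : ℝ, φ (x : UnitAddCircle) = ((F x : ℝ) : UnitAddCircle)) (n : ℕ) (x : ℝ) :
    φ^[n] (x : UnitAddCircle) = ((F^[n] x : ℝ) : UnitAddCircle) := by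
  induction n generalizing x with
  | zero => rfl
  | succ k ih => rw [Function.iterate_succ_apply, Function.iterate_succ_apply, hφ, ih]

theorem unitAddCircle_coe_eq_iff (x y : ℝ) :
    (x : UnitAddCircle) = (y : UnitAddCircle) ↔ ∃ m : ℤ, x = y + m := by
  rw [← sub_eq_zero, ← AddCircle.coe_sub, AddCircle.coe_eq_zero_iff]
  refine exists_congr fun m => ?_
  rw [zsmul_eq_mul, mul_one]
  constructor <;> intro h <;> linarith

/-- Open intervals of length at most one that are pairwise disjoint modulo `ℤ` have total length
at most one. -/
theorem sum_length_le_one {n : ℕ} (x y : ℕ → ℝ) (hxy : ∀ i < n, y i ≤ x i + 1)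
    (hdisj : ∀ i < n, ∀ j < n, i < j → ∀ m : ℤ, ∀ t : ℝ,
      t ∈ Ioo (x i) (y i) → t + m ∉ Ioo (x j) (y j)) :
    ∑ i ∈ Finset.range n, (y i - x i) ≤ 1 := by
  set B : ℕ → Set UnitAddCircle := fun i =>
    Metric.ball (((x i + y i) / 2 : ℝ) : UnitAddCircle) ((y i - x i) / 2) with hB
  have hmem : ∀ i (t : ℝ), (t : UnitAddCircle) ∈ B i → ∃ m : ℤ, t + m ∈ Ioo (x i) (y i) := by
    intro i t ht
    rw [hB, Metric.mem_ball, dist_eq_norm, ← AddCircle.coe_sub, UnitAddCircle.norm_eq,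
      abs_lt] at ht
    refine ⟨-round (t - (x i + y i) / 2), ?_, ?_⟩ <;> push_cast <;> linarith [ht.1, ht.2]
  have hpd : ((Finset.range n : Finset ℕ) : Set ℕ).PairwiseDisjoint B := by
    have key : ∀ i < n, ∀ j < n, i < j → Disjoint (B i) (B j) := by
      intro i hi j hj hij
      rw [Set.disjoint_left]
      intro z hz1 hz2
      induction z using QuotientAddGroup.induction_on with
      | H t =>
        obtain ⟨m, hm⟩ := hmem i t hz1
        obtain ⟨k, hk⟩ := hmem j t hz2
        refine hdisj i hi j hj hij (k - m) (t + m) hm ?_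
        push_cast
        convert hk using 1
        ring
    intro i hi j hj hij
    rw [Finset.coe_range, mem_Iio] at hi hj
    rcases lt_or_gt_of_ne hij with h | h
    · exact key i hi j hj h
    · exact (key j hj i hi h).symm
  have hvol : ∀ i < n, ENNReal.ofReal (y i - x i) = volume (B i) := by
    intro i hi
    rw [hB, ← measure_congr AddCircle.closedBall_ae_eq_ball, AddCircle.volume_closedBall,
      min_eq_right (by linarith [hxy i hi])]
    congr 1
    ring
  have h1 : ∑ i ∈ Finset.range n, volume (B i) ≤ 1 := by
    rw [← measure_biUnion_finset hpd fun i _ => measurableSet_ball]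
    refine (measure_mono (subset_univ _)).trans ?_
    rw [AddCircle.measure_univ, ENNReal.ofReal_one]
  have h2 : ENNReal.ofReal (∑ i ∈ Finset.range n, (y i - x i)) ≤ 1 :=
    calc ENNReal.ofReal (∑ i ∈ Finset.range n, (y i - x i))
        ≤ ∑ i ∈ Finset.range n, ENNReal.ofReal (y i - x i) :=
          Finset.le_sum_of_subadditive _ ENNReal.ofReal_zero.le (fun _ _ => ENNReal.ofReal_add_le) _ _
      _ = ∑ i ∈ Finset.range n, volume (B i) :=
          Finset.sum_congr rfl fun i hi => hvol i (Finset.mem_range.1 hi)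
      _ ≤ 1 := h1
  exact ENNReal.ofReal_le_one.1 h2

/-! ### The semiconjugacy to doubling -/

/-- `h` is a monotone degree-one semiconjugacy from `F` to `x ↦ 2 * x`. -/
structure IsDoublingSemiconj (F h : ℝ → ℝ) : Prop where
  continuous : Continuous h
  monotone : Monotone h
  add_one : ∀ x, h (x + 1) = h x + 1
  semiconj : ∀ x, h (F x) = 2 * h x

theorem exists_semiconj_doubling {F : ℝ → ℝ} (hcont : Continuous F) (hmono : StrictMono F)
    (hF : ∀ x, F (x + 1) = F x + 2) :
    ∃ h : ℝ → ℝ, IsDoublingSemiconj F h := by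
  set g : ℝ → ℝ := fun x => F x - 2 * x with hg
  have hgc : Continuous g := by fun_prop
  have hgp : Function.Periodic g 1 := fun x => by simp only [hg, hF]; ring
  obtain ⟨M, hM⟩ : ∃ M, ∀ x, ‖g x‖ ≤ M := by
    obtain ⟨M, hM⟩ := (hgp.compact_of_continuous one_ne_zero hgc).isBounded.exists_norm_le
    exact ⟨M, fun x => hM _ (mem_range_self x)⟩
  set u : ℕ → ℝ → ℝ := fun n x => g (F^[n] x) / 2 ^ (n + 1) with hu
  have hbound : ∀ n x, ‖u n x‖ ≤ M * (1 / 2) ^ n := by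
    intro n x
    rw [hu, norm_div, norm_pow, Real.norm_ofNat, div_eq_mul_inv, ← inv_pow, ← one_div]
    have : ((1 : ℝ) / 2) ^ (n + 1) ≤ (1 / 2) ^ n :=
      pow_le_pow_of_le_one (by norm_num) (by norm_num) (Nat.le_succ n)
    exact mul_le_mul (hM _) this (by positivity) ((norm_nonneg _).trans (hM 0))
  have hsum : Summable fun n : ℕ => M * (1 / 2 : ℝ) ^ n :=
    summable_geometric_two.mul_left M
  have husum : ∀ x, Summable fun n => u n x := fun x =>
    Summable.of_norm_bounded hsum fun n => hbound n x
  have hpart : ∀ n x, x + ∑ i ∈ Finset.range n, u i x = F^[n] x / 2 ^ n := by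
    intro n x
    induction n with
    | zero => simp
    | succ k ih =>
      rw [Finset.sum_range_succ, ← add_assoc, ih, Function.iterate_succ_apply']
      simp only [hu, hg]
      field_simp
      ring
  refine ⟨fun x => x + ∑' n, u n x, ?_, ?_, ?_, ?_⟩
  · refine continuous_id.add (continuous_tsum (fun n => ?_) hsum hbound)
    exact (hgc.comp (hcont.iterate n)).div_const _
  · intro x y hxy
    have lim : ∀ x, Tendsto (fun n => F^[n] x / 2 ^ n) atTop (𝓝 (x + ∑' n, u n x)) := by
      intro x
      simp_rw [← hpart]
      exact (husum x).hasSum.tendsto_sum_nat.const_add x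
    refine le_of_tendsto_of_tendsto' (lim x) (lim y) fun n => ?_
    have := hmono.monotone.iterate n hxy
    gcongr
  · intro x
    have : ∀ n, u n (x + 1) = u n x := by
      intro n
      have h1 := lift_iterate_add_int hF n x 1
      have h2 := hgp.int_mul (2 ^ n) (F^[n] x)
      push_cast at h1 h2
      simp only [hu, h1, h2]
    simp only [this]
    ring
  · intro x
    have : ∀ n, u n (F x) = 2 * u (n + 1) x := by
      intro n
      simp only [hu, ← Function.iterate_succ_apply]
      field_simp
      ring
    simp only [this]
    rw [tsum_mul_left, (husum x).tsum_eq_zero_add]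
    simp only [hu, hg, Function.iterate_zero, id]
    ring

namespace IsDoublingSemiconj

variable {F h : ℝ → ℝ}

theorem iterate (hh : IsDoublingSemiconj F h) (n : ℕ) (x : ℝ) :
    h (F^[n] x) = 2 ^ n * h x := by
  induction n with
  | zero => simp
  | succ k ih => rw [Function.iterate_succ_apply', hh.semiconj, ih]; ring

theorem add_int (hh : IsDoublingSemiconj F h) (x : ℝ) (m : ℤ) : h (x + m) = h x + m := by
  have hp : Function.Periodic (fun x => h x - x) 1 := fun x => by simp only [hh.add_one]; ring
  have := hp.int_mul m x
  simp only [mul_one] at this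
  linarith

theorem lt_of_lt (hh : IsDoublingSemiconj F h) {x y : ℝ} (hxy : h x < h y) : x < y :=
  lt_of_not_ge fun hle => hxy.not_ge (hh.monotone hle)

end IsDoublingSemiconj

/-! ### Bounded distortion -/

/-- `F` is a `C²` lift, with positive derivative, of a degree-two circle covering. -/
structure IsSmoothLift (F : ℝ → ℝ) : Prop where
  contDiff : ContDiff ℝ 2 F
  deriv_pos : ∀ x, 0 < deriv F x
  add_one : ∀ x, F (x + 1) = F x + 2

namespace IsSmoothLift

variable {F : ℝ → ℝ}

theorem differentiable (hF : IsSmoothLift F) : Differentiable ℝ F :=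
  hF.contDiff.differentiable (by norm_num)

theorem continuous (hF : IsSmoothLift F) : Continuous F := hF.contDiff.continuous

theorem strictMono (hF : IsSmoothLift F) : StrictMono F := strictMono_of_deriv_pos hF.deriv_pos

theorem strictMono_iterate (hF : IsSmoothLift F) (n : ℕ) : StrictMono F^[n] :=
  hF.strictMono.iterate n

theorem iterate_add_int (hF : IsSmoothLift F) (n : ℕ) (x : ℝ) (m : ℤ) :
    F^[n] (x + m) = F^[n] x + 2 ^ n * m :=
  lift_iterate_add_int hF.add_one n x m

theorem deriv_iterate_succ (hF : IsSmoothLift F) (n : ℕ) (x : ℝ) :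
    deriv F^[n + 1] x = deriv F (F^[n] x) * deriv F^[n] x := by
  rw [Function.iterate_succ']
  exact deriv_comp x (hF.differentiable _) (hF.differentiable.iterate n _)

theorem deriv_iterate_pos (hF : IsSmoothLift F) (n : ℕ) (x : ℝ) : 0 < deriv F^[n] x := by
  induction n with
  | zero => simp
  | succ k ih => rw [hF.deriv_iterate_succ]; exact mul_pos (hF.deriv_pos _) ih

theorem deriv_iterate_add_int (hF : IsSmoothLift F) (n : ℕ) (x : ℝ) (m : ℤ) :
    deriv F^[n] (x + m) = deriv F^[n] x := by
  rw [← deriv_comp_add_const]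
  simp only [hF.iterate_add_int]
  exact deriv_add_const _

theorem exists_lipschitz_log_deriv (hF : IsSmoothLift F) :
    ∃ L, 0 ≤ L ∧ ∀ x y, Real.log (deriv F x) - Real.log (deriv F y) ≤ L * |x - y| := by
  have hC1 : ContDiff ℝ 1 (deriv F) := by
    have := hF.contDiff
    rw [show (2 : WithTop ℕ∞) = 1 + 1 by norm_num, contDiff_succ_iff_deriv] at this
    exact this.2.2
  have hd : Differentiable ℝ (deriv F) := hC1.differentiable one_ne_zero
  have hper : Function.Periodic (deriv F) 1 := fun x => by
    simpa using hF.deriv_iterate_add_int 1 x 1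
  set G : ℝ → ℝ := fun x => deriv (deriv F) x / deriv F x with hG
  have hGc : Continuous G :=
    (hC1.continuous_deriv le_rfl).div hC1.continuous fun x => (hF.deriv_pos x).ne'
  have hGp : Function.Periodic G 1 := fun x => by
    simp only [hG, hper x]
    rw [← deriv_comp_add_const]
    simp only [hper _]
  obtain ⟨M, hM⟩ : ∃ M, ∀ x, ‖G x‖ ≤ M := by
    obtain ⟨M, hM⟩ := (hGp.compact_of_continuous one_ne_zero hGc).isBounded.exists_norm_le
    exact ⟨M, fun x => hM _ (mem_range_self x)⟩
  refine ⟨M, (norm_nonneg _).trans (hM 0), fun x y => (le_abs_self _).trans ?_⟩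
  refine convex_univ.norm_image_sub_le_of_norm_hasDerivWithin_le
    (f := fun x => Real.log (deriv F x)) (fun z _ => ?_) (fun z _ => hM z)
    (mem_univ y) (mem_univ x)
  exact ((hd z).hasDerivAt.log (hF.deriv_pos z).ne').hasDerivWithinAt

theorem deriv_iterate_le (hF : IsSmoothLift F) {L : ℝ} (hL0 : 0 ≤ L)
    (hL : ∀ x y, Real.log (deriv F x) - Real.log (deriv F y) ≤ L * |x - y|)
    {n : ℕ} {u v S : ℝ} (hS : ∑ i ∈ Finset.range n, (F^[i] v - F^[i] u) ≤ S)
    {x y : ℝ} (hx : x ∈ Icc u v) (hy : y ∈ Icc u v) :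
    deriv F^[n] x ≤ Real.exp (L * S) * deriv F^[n] y := by
  suffices deriv F^[n] x ≤
      Real.exp (L * ∑ i ∈ Finset.range n, (F^[i] v - F^[i] u)) * deriv F^[n] y by
    refine this.trans (mul_le_mul_of_nonneg_right ?_ (hF.deriv_iterate_pos n y).le)
    exact Real.exp_le_exp.2 (mul_le_mul_of_nonneg_left hS hL0)
  clear hS
  induction n with
  | zero => simp
  | succ k ih =>
    rw [hF.deriv_iterate_succ, hF.deriv_iterate_succ, Finset.sum_range_succ, mul_add,
      Real.exp_add]
    have h1 : deriv F (F^[k] x) ≤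
        Real.exp (L * (F^[k] v - F^[k] u)) * deriv F (F^[k] y) := by
      have hmono := (hF.strictMono_iterate k).monotone
      have habs : |F^[k] x - F^[k] y| ≤ F^[k] v - F^[k] u := by
        rw [abs_le]
        constructor <;> linarith [hmono hx.1, hmono hx.2, hmono hy.1, hmono hy.2]
      have h2 := (hL (F^[k] x) (F^[k] y)).trans (mul_le_mul_of_nonneg_left habs hL0)
      rw [← Real.log_le_log_iff (hF.deriv_pos _) (mul_pos (Real.exp_pos _) (hF.deriv_pos _)),
        Real.log_mul (Real.exp_pos _).ne' (hF.deriv_pos _).ne', Real.log_exp]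
      linarith
    calc _ ≤ (Real.exp (L * (F^[k] v - F^[k] u)) * deriv F (F^[k] y)) *
          (Real.exp (L * ∑ i ∈ Finset.range k, (F^[i] v - F^[i] u)) * deriv F^[k] y) :=
          mul_le_mul h1 ih (hF.deriv_iterate_pos k x).le
            (mul_pos (Real.exp_pos _) (hF.deriv_pos _)).le
      _ = _ := by ring

theorem exists_deriv_iterate_mul_eq (hF : IsSmoothLift F) (n : ℕ) {x y : ℝ} (hxy : x ≤ y) :
    ∃ z ∈ Icc x y, F^[n] y - F^[n] x = deriv F^[n] z * (y - x) := by
  rcases hxy.eq_or_lt with rfl | hlt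
  · exact ⟨x, left_mem_Icc.2 le_rfl, by simp⟩
  · have hd := hF.differentiable.iterate n
    obtain ⟨z, hz, hz'⟩ :=
      exists_deriv_eq_slope F^[n] hlt hd.continuous.continuousOn hd.differentiableOn
    refine ⟨z, Ioo_subset_Icc_self hz, ?_⟩
    rw [hz', div_mul_cancel₀ _ (sub_ne_zero.2 hlt.ne')]

theorem iterate_sub_le (hF : IsSmoothLift F) {L : ℝ} (hL0 : 0 ≤ L)
    (hL : ∀ x y, Real.log (deriv F x) - Real.log (deriv F y) ≤ L * |x - y|)
    {n : ℕ} {u v S : ℝ} (hS : ∑ i ∈ Finset.range n, (F^[i] v - F^[i] u) ≤ S)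
    {x y z : ℝ} (hx : u ≤ x) (hxy : x ≤ y) (hy : y ≤ v) (hz : z ∈ Icc u v) :
    F^[n] y - F^[n] x ≤ Real.exp (L * S) * deriv F^[n] z * (y - x) := by
  obtain ⟨w, hw, hw'⟩ := hF.exists_deriv_iterate_mul_eq n hxy
  rw [hw']
  exact mul_le_mul_of_nonneg_right
    (hF.deriv_iterate_le hL0 hL hS ⟨hx.trans hw.1, hw.2.trans hy⟩ hz) (sub_nonneg.2 hxy)

theorem iterate_sub_mul_le (hF : IsSmoothLift F) {L : ℝ} (hL0 : 0 ≤ L)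
    (hL : ∀ x y, Real.log (deriv F x) - Real.log (deriv F y) ≤ L * |x - y|)
    {n : ℕ} {u v S : ℝ} (hS : ∑ i ∈ Finset.range n, (F^[i] v - F^[i] u) ≤ S)
    {x y x' y' : ℝ} (hx : u ≤ x) (hxy : x ≤ y) (hy : y ≤ v)
    (hx' : u ≤ x') (hxy' : x' ≤ y') (hy' : y' ≤ v) :
    (F^[n] y - F^[n] x) * (y' - x') ≤ Real.exp (L * S) * (F^[n] y' - F^[n] x') * (y - x) := by
  obtain ⟨w, hw, hw'⟩ := hF.exists_deriv_iterate_mul_eq n hxy'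
  have := mul_le_mul_of_nonneg_right
    (hF.iterate_sub_le hL0 hL hS hx hxy hy ⟨hx'.trans hw.1, hw.2.trans hy'⟩)
    (sub_nonneg.2 hxy')
  rw [hw']
  linarith

/-- Absence of wandering intervals: a value of the semiconjugacy attained on a nondegenerate
interval is rational. -/
theorem exists_nat_mul_semiconj_eq_int (hF : IsSmoothLift F) {h : ℝ → ℝ}
    (hh : IsDoublingSemiconj F h) {g g' : ℝ} (hg : g < g') (heq : h g = h g') :
    ∃ Q : ℕ, 0 < Q ∧ ∃ n : ℤ, Q * h g = n := by
  by_contra! hcon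
  have hne : ∀ i j : ℕ, i < j → ∀ n : ℤ, 2 ^ i * h g + n ≠ 2 ^ j * h g := by
    intro i j hij n hn
    have hlt : 2 ^ i < 2 ^ j := Nat.pow_lt_pow_right (by norm_num) hij
    refine hcon (2 ^ j - 2 ^ i) (by omega) n ?_
    push_cast [hlt.le]
    linarith
  obtain ⟨L, hL0, hL⟩ := hF.exists_lipschitz_log_deriv
  obtain ⟨b, hgb, hb, hbmax⟩ : ∃ b, g < b ∧ h b = h g ∧ ∀ x, b < x → h g < h x := by
    have hbdd : BddAbove {x | h x = h g} := by
      refine ⟨g + 1, fun x (hx : h x = h g) => (hh.lt_of_lt ?_).le⟩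
      rw [hh.add_one, hx]; linarith
    have hmem : sSup {x | h x = h g} ∈ {x | h x = h g} :=
      (isClosed_eq hh.continuous continuous_const).csSup_mem ⟨g, rfl⟩ hbdd
    refine ⟨_, hg.trans_le (le_csSup hbdd heq.symm), hmem, fun x hx => ?_⟩
    refine lt_of_le_of_ne (hmem.symm.le.trans (hh.monotone hx.le)) fun hxg => ?_
    exact hx.not_ge (le_csSup hbdd hxg.symm)
  have hconst : ∀ i, ∀ x ∈ Icc (F^[i] g) (F^[i] b), h x = 2 ^ i * h g := by
    intro i x hx
    refine le_antisymm ?_ ?_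
    · rw [← hb, ← hh.iterate]; exact hh.monotone hx.2
    · rw [← hh.iterate]; exact hh.monotone hx.1
  have hle : ∀ i, F^[i] b ≤ F^[i] g + 1 := by
    refine fun i => (hh.lt_of_lt ?_).le
    rw [hh.add_one, hh.iterate, hh.iterate, hb]; linarith
  have hsum : ∀ n, ∑ i ∈ Finset.range n, (F^[i] b - F^[i] g) ≤ 1 := by
    intro n
    refine sum_length_le_one (fun i => F^[i] g) (fun i => F^[i] b) (fun i _ => hle i) ?_
    intro i _ j _ hij m t ht htm
    refine hne i j hij m ?_
    rw [← hconst i t (Ioo_subset_Icc_self ht), ← hh.add_int,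
      hconst j _ (Ioo_subset_Icc_self htm)]
  set E := Real.exp (L * 2) with hE
  have hEpos : 0 < E := Real.exp_pos _
  set y := b + (b - g) / E with hy
  have hby : b < y := by
    have : 0 < (b - g) / E := div_pos (sub_pos.2 hgb) hEpos
    linarith
  have hgrow : ∀ n, F^[n] y - F^[n] b ≤ F^[n] b - F^[n] g := by
    intro n
    induction n using Nat.strong_induction_on with
    | _ n ih =>
      have hS : ∑ i ∈ Finset.range n, (F^[i] y - F^[i] g) ≤ 2 := by
        calc ∑ i ∈ Finset.range n, (F^[i] y - F^[i] g)
            ≤ ∑ i ∈ Finset.range n, 2 * (F^[i] b - F^[i] g) := by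
              refine Finset.sum_le_sum fun i hi => ?_
              linarith [ih i (Finset.mem_range.1 hi)]
          _ = 2 * ∑ i ∈ Finset.range n, (F^[i] b - F^[i] g) := Finset.mul_sum _ _ _ |>.symm
          _ ≤ 2 := by linarith [hsum n]
      have := hF.iterate_sub_mul_le hL0 hL hS hgb.le hby.le le_rfl le_rfl hgb.le hby.le
      rw [← hE, show y - b = (b - g) / E by rw [hy]; ring] at this
      have h2 : E * (F^[n] b - F^[n] g) * ((b - g) / E) = (F^[n] b - F^[n] g) * (b - g) := by
        field_simp
      rw [h2] at this
      exact le_of_mul_le_mul_right this (sub_pos.2 hgb)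
  have hy1 : ∀ n, 2 ^ n * (h y - h g) ≤ 1 := by
    intro n
    have h1 : F^[n] y ≤ F^[n] b + 1 := by linarith [hgrow n, hle n]
    have h2 := hh.monotone h1
    rw [hh.add_one, hh.iterate, hh.iterate, hb] at h2
    linarith
  obtain ⟨n, hn⟩ := pow_unbounded_of_one_lt (1 / (h y - h g)) (one_lt_two (α := ℝ))
  rw [div_lt_iff₀ (sub_pos.2 (hbmax y hby))] at hn
  exact hn.not_ge (hy1 n)

end IsSmoothLift

/-! ### Closest returns to a fixed point -/

namespace IsSmoothLift

variable {F h : ℝ → ℝ} {a : ℝ}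

theorem semiconj_fixed_eq_zero (hh : IsDoublingSemiconj F h) (ha : F a = a) : h a = 0 := by
  have := hh.semiconj a
  rw [ha] at this
  linarith

theorem eventually_iterate_gt (hF : IsSmoothLift F) (hh : IsDoublingSemiconj F h) (ha : F a = a)
    (hpos : ∀ x, a < x → 0 < h x) {g g' : ℝ} (hg : g < g') :
    ∀ᶠ δ in 𝓝[>] (0 : ℝ), ∀ (k : ℕ) (m : ℤ), a + m ≤ F^[k] g → a + m + δ < F^[k] g' := by
  have h0 := semiconj_fixed_eq_zero hh ha
  have hlim : Tendsto (fun δ => h (a + δ)) (𝓝[>] (0 : ℝ)) (𝓝 0) := by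
    have : Continuous fun δ => h (a + δ) := hh.continuous.comp (continuous_const_add a)
    have h1 := this.tendsto 0
    rw [add_zero, h0] at h1
    exact h1.mono_left nhdsWithin_le_nhds
  have hshift : ∀ (m : ℤ) (δ : ℝ), h (a + m + δ) = h (a + δ) + m := by
    intro m δ
    rw [add_right_comm, hh.add_int]
  rcases (hh.monotone hg.le).eq_or_lt with heq | hlt
  · obtain ⟨Q, hQ, n, hn⟩ := hF.exists_nat_mul_semiconj_eq_int hh hg heq
    have hQ' : (0 : ℝ) < Q := Nat.cast_pos.2 hQ
    filter_upwards [hlim.eventually_lt_const (inv_pos.2 hQ')] with δ hδ k m hk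
    refine hh.lt_of_lt ?_
    have h1 : 0 < h (F^[k] g' - m) := by
      refine hpos _ ?_
      linarith [hF.strictMono_iterate k hg]
    rw [sub_eq_add_neg, ← Int.cast_neg, hh.add_int, hh.iterate, ← heq] at h1
    rw [hshift, hh.iterate, ← heq]
    push_cast at h1
    have h2 : (Q : ℝ) * (2 ^ k * h g + -m) = ((2 ^ k * n - Q * m : ℤ) : ℝ) := by
      push_cast
      rw [← hn]
      ring
    have h3 : (1 : ℝ) ≤ Q * (2 ^ k * h g + -m) := by
      have h4 := mul_pos hQ' h1
      rw [h2] at h4 ⊢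
      exact_mod_cast h4
    have h5 : (Q : ℝ)⁻¹ ≤ 2 ^ k * h g + -m := (inv_le_iff_one_le_mul₀' hQ').2 h3
    linarith
  · filter_upwards [hlim.eventually_lt_const (sub_pos.2 hlt)] with δ hδ k m hk
    refine hh.lt_of_lt ?_
    have h1 := hh.monotone hk
    rw [hh.add_int, h0, hh.iterate] at h1
    rw [hshift, hh.iterate]
    have h2 : h g' - h g ≤ 2 ^ k * (h g' - h g) :=
      le_mul_of_one_le_left (sub_pos.2 hlt).le (one_le_pow₀ one_le_two)
    linarith

/-- Preimages of short intervals based at the fixed point are short, uniformly in the number of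
iterations. -/
theorem exists_iterate_gt_of_le_sub (hF : IsSmoothLift F) (hh : IsDoublingSemiconj F h)
    (ha : F a = a) (hpos : ∀ x, a < x → 0 < h x) {η : ℝ} (hη : 0 < η) :
    ∃ δ > 0, ∀ x y, η ≤ y - x → ∀ (k : ℕ) (m : ℤ), a + m ≤ F^[k] x → a + m + δ < F^[k] y := by
  obtain ⟨M, hM⟩ := exists_nat_gt (2 / η)
  have hM0 : (0 : ℝ) < M := lt_trans (by positivity) hM
  have hMη : 2 ≤ η * M := by
    rw [div_lt_iff₀ hη] at hM
    linarith
  have hgrid : ∀ᶠ δ in 𝓝[>] (0 : ℝ), ∀ l ∈ Finset.range M, ∀ (k : ℕ) (m : ℤ),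
      a + m ≤ F^[k] ((l : ℝ) / M) → a + m + δ < F^[k] (((l : ℝ) + 1) / M) := by
    rw [eventually_all_finset]
    intro l _
    exact hF.eventually_iterate_gt hh ha hpos (by gcongr; linarith)
  obtain ⟨δ, hδ, hδ0⟩ := (hgrid.and self_mem_nhdsWithin).exists
  refine ⟨δ, hδ0, fun x y hxy k m hk => ?_⟩
  set j : ℤ := ⌈x * M⌉ with hj
  have hMZ : (0 : ℤ) < M := by exact_mod_cast hM0
  obtain ⟨l, hl⟩ := Int.eq_ofNat_of_zero_le (Int.emod_nonneg j hMZ.ne')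
  have hlM : l < M := by
    have := Int.emod_lt_of_pos j hMZ
    omega
  set r : ℤ := j / M with hr
  have hjlr : (j : ℝ) = l + M * r := by
    have h1 := Int.emod_add_mul_ediv j M
    rw [hl] at h1
    exact_mod_cast h1.symm
  have hx : x ≤ (l : ℝ) / M + r := by
    have h1 : x * M ≤ j := Int.le_ceil _
    rw [div_add' _ _ _ hM0.ne', le_div_iff₀ hM0]
    linarith
  have hy : ((l : ℝ) + 1) / M + r ≤ y := by
    have h1 : (j : ℝ) < x * M + 1 := Int.ceil_lt_add_one _
    rw [div_add' _ _ _ hM0.ne', div_le_iff₀ hM0]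
    nlinarith
  have hx' := (hF.strictMono_iterate k).monotone hx
  have hy' := (hF.strictMono_iterate k).monotone hy
  rw [hF.iterate_add_int] at hx' hy'
  have h1 := hδ l (Finset.mem_range.2 hlM) k (m - 2 ^ k * r)
  push_cast at h1
  linarith [h1 (by linarith)]

/-- The orbit of a periodic point closest on the right to the fixed point has disjoint pullbacks
of the interval between them. -/
theorem sum_pullback_le_one (hF : IsSmoothLift F) {p z : ℝ} {t : ℕ} {m : ℤ}
    (hpa : p < a + 1) (hz : F^[t] z = a + m) (hp : F^[t] p = p + m)
    (hclosest : ∀ (i : ℕ) (n : ℤ), F^[i] p + n ∉ Ioo a p)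
    (hmin : ∀ i, 0 < i → i < t → ∀ n : ℤ, F^[i] p ≠ p + n) :
    ∑ i ∈ Finset.range t, (F^[i] p - F^[i] z) ≤ 1 := by
  refine sum_length_le_one (fun i => F^[i] z) (fun i => F^[i] p) (fun i hi => ?_) ?_
  · by_contra! hlt
    have h1 := hF.strictMono_iterate (t - i) hlt
    have h2 := hF.iterate_add_int (t - i) (F^[i] z) 1
    push_cast at h2
    rw [h2, ← Function.iterate_add_apply, ← Function.iterate_add_apply, Nat.sub_add_cancel hi.le,
      hz, hp] at h1
    have h3 : (1 : ℝ) ≤ 2 ^ (t - i) := one_le_pow₀ one_le_two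
    linarith
  · rintro i - j hj hij n τ ⟨hτ1, hτ2⟩ ⟨hτ3, hτ4⟩
    obtain ⟨r, rfl⟩ := Nat.exists_eq_add_of_lt hj
    obtain ⟨k, rfl⟩ := Nat.exists_eq_add_of_lt hij
    set r' := r + 1
    set k' := k + 1
    have hτ1 := hF.strictMono_iterate r' hτ1
    have hτ2 := hF.strictMono_iterate r' hτ2
    have hτ3 := hF.strictMono_iterate r' hτ3
    have hτ4 := hF.strictMono_iterate r' hτ4
    simp only [hF.iterate_add_int, ← Function.iterate_add_apply] at hτ1 hτ2 hτ3 hτ4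
    rw [show r' + (i + k + 1) = i + k + 1 + r + 1 by omega, hz] at hτ3
    rw [show r' + (i + k + 1) = i + k + 1 + r + 1 by omega, hp] at hτ4
    set n' : ℤ := m - 2 ^ r' * n with hn'
    have hn'' : (n' : ℝ) = m - 2 ^ r' * n := by rw [hn']; push_cast; ring
    have h1 : p + n' < F^[r' + i] p := by
      have h2 := hclosest (r' + i) (-n')
      have h3 := hmin (r' + i) (by omega) (by omega) n'
      rw [mem_Ioo, not_and_or, not_lt, not_lt] at h2
      push_cast at h2
      refine lt_of_le_of_ne ?_ h3.symm
      rcases h2 with h2 | h2 <;> linarith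
    have h4 : F^[r' + i] z < p + n' := by linarith
    have h1 := hF.strictMono_iterate k' h1
    have h4 := hF.strictMono_iterate k' h4
    simp only [hF.iterate_add_int, ← Function.iterate_add_apply] at h1 h4
    rw [show k' + (r' + i) = i + k + 1 + r + 1 by omega, hp] at h1
    rw [show k' + (r' + i) = i + k + 1 + r + 1 by omega, hz] at h4
    refine hclosest k' (2 ^ k' * n' - m) ⟨?_, ?_⟩ <;> push_cast <;> linarith

theorem exists_le_deriv_iterate_of_closest (hF : IsSmoothLift F) (hh : IsDoublingSemiconj F h)
    (ha : F a = a) (hpos : ∀ x, a < x → 0 < h x) {K : ℝ} (hK : 0 < K) :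
    ∃ ε > 0, ∀ (p : ℝ) (t : ℕ) (m : ℤ), 1 ≤ t → a < p → p < a + ε → F^[t] p = p + m →
      (∀ (i : ℕ) (n : ℤ), F^[i] p + n ∉ Ioo a p) →
      (∀ i, 0 < i → i < t → ∀ n : ℤ, F^[i] p ≠ p + n) → K ≤ deriv F^[t] p := by
  obtain ⟨L, hL0, hL⟩ := hF.exists_lipschitz_log_deriv
  have hlt : ∀ x, a < x → x < F x := fun x hx => hh.lt_of_lt <| by
    rw [hh.semiconj]; linarith [hpos x hx]
  have hfix : ∀ n, F^[n] a = a := fun n => Function.iterate_fixed ha n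
  have hgt : ∀ n x, a < x → a < F^[n] x := fun n x hx => by
    simpa only [hfix] using hF.strictMono_iterate n hx
  have hpre : ∀ y, a < y → ∃ x, a < x ∧ x < y ∧ F x = y := by
    intro y hy
    obtain ⟨x, hx, hxy⟩ := intermediate_value_Icc hy.le hF.continuous.continuousOn
      (show y ∈ Icc (F a) (F y) from ⟨ha.symm ▸ hy.le, (hlt y hy).le⟩)
    have hax : a < x := by
      refine lt_of_le_of_ne hx.1 ?_
      rintro rfl
      exact hy.ne (ha.symm.trans hxy)
    exact ⟨x, hax, hxy ▸ hlt x hax, hxy⟩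
  obtain ⟨q, haq, hq1, hFq⟩ := hpre (a + 1) (lt_add_one a)
  obtain ⟨q', haq', hq'q, hFq'⟩ := hpre q haq
  obtain ⟨c, hc, hcle⟩ : ∃ c > 0, ∀ w ∈ Icc q' q, c ≤ F w - w := by
    obtain ⟨w, hw, hwmin⟩ := isCompact_Icc.exists_isMinOn (nonempty_Icc.2 hq'q.le)
      (hF.continuous.sub continuous_id).continuousOn
    exact ⟨F w - w, sub_pos.2 (hlt w (haq'.trans_le hw.1)), fun v hv => hwmin hv⟩
  set E := Real.exp (L * 1) with hE
  have hEpos : 0 < E := Real.exp_pos _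
  set η := c / (E * E * K) with hη
  have hηpos : 0 < η := by positivity
  obtain ⟨δ, hδ, hδη⟩ := hF.exists_iterate_gt_of_le_sub hh ha hpos hηpos
  refine ⟨min δ (q - a), lt_min hδ (sub_pos.2 haq), fun p t m ht hap hpε hp hclosest hmin => ?_⟩
  have hpδ : p < a + δ := hpε.trans_le (by linarith [min_le_left δ (q - a)])
  have hpq : p < q := hpε.trans_le (by linarith [min_le_right δ (q - a)])
  obtain ⟨p₁, hap₁, hp₁p, hFp₁⟩ := hpre p hap
  have hex : ∃ n, q ≤ F^[n] p := by
    obtain ⟨n, hn⟩ := pow_unbounded_of_one_lt (h q / h p) (one_lt_two (α := ℝ))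
    rw [div_lt_iff₀ (hpos p hap)] at hn
    exact ⟨n, (hh.lt_of_lt (by rwa [hh.iterate])).le⟩
  obtain ⟨N, hN, hNmin⟩ : ∃ N, q ≤ F^[N] p ∧ ∀ k < N, F^[k] p < q := by
    classical
    exact ⟨Nat.find hex, Nat.find_spec hex, fun k hk => not_le.1 (Nat.find_min hex hk)⟩
  obtain ⟨N', rfl⟩ : ∃ N', N = N' + 1 := by
    refine Nat.exists_eq_succ_of_ne_zero ?_
    rintro rfl
    exact hpq.not_ge hN
  have hsucc : ∀ i, F^[i + 1] p₁ = F^[i] p := fun i => by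
    rw [Function.iterate_succ_apply, hFp₁]
  have hw1 : F^[N'] p < q := hNmin N' (Nat.lt_succ_self _)
  have hw2 : q' ≤ F^[N'] p := by
    rw [← hF.strictMono.le_iff_le, hFq', ← Function.iterate_succ_apply' F]
    exact hN
  have hcN : c ≤ F^[N' + 1] p - F^[N' + 1] p₁ := by
    rw [hsucc, Function.iterate_succ_apply']
    exact hcle _ ⟨hw2, hw1.le⟩
  have hsumN : ∑ i ∈ Finset.range (N' + 1), (F^[i] p - F^[i] p₁) ≤ 1 := by
    simp only [← hsucc]
    rw [Finset.sum_range_sub (fun i => F^[i] p₁), hsucc, Function.iterate_zero, id]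
    linarith
  have hm : (1 : ℝ) ≤ m := by
    have h1 : p < F^[t] p := by
      obtain ⟨t', rfl⟩ := Nat.exists_eq_add_of_le' ht
      refine hh.lt_of_lt ?_
      rw [hh.iterate]
      exact lt_mul_of_one_lt_left (hpos p hap) (one_lt_pow₀ one_lt_two (Nat.succ_ne_zero _))
    have h2 : (0 : ℝ) < m := by linarith
    exact_mod_cast h2
  obtain ⟨z, hz, hFz⟩ := intermediate_value_Icc hap.le
    (hF.differentiable.iterate t).continuous.continuousOn
    (show a + m ∈ Icc (F^[t] a) (F^[t] p) by
      rw [hfix, hp]; constructor <;> linarith)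
  have hp₁z : p₁ ≤ z := by
    by_contra! hzp
    obtain ⟨t', rfl⟩ := Nat.exists_eq_add_of_le' ht
    have h1 := hF.strictMono_iterate (t' + 1) hzp
    have h2 := hF.strictMono_iterate (t' + 1) hp₁p
    rw [hsucc] at h1 h2
    refine hclosest t' (-m) ⟨?_, ?_⟩ <;> push_cast <;> linarith
  have hzp : z < p := by
    rw [← (hF.strictMono_iterate t).lt_iff_lt, hFz, hp]
    linarith
  have hNt : N' + 1 ≤ t := by
    by_contra! hlt'
    have := hNmin t hlt'
    linarith
  have hsmall : F^[N' + 1] p - F^[N' + 1] z < η := by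
    by_contra! hle
    have h1 := hδη _ _ hle (t - (N' + 1)) m
    rw [← Function.iterate_add_apply, ← Function.iterate_add_apply, Nat.sub_add_cancel hNt,
      hFz, hp] at h1
    linarith [h1 le_rfl]
  have hshort := hF.iterate_sub_mul_le hL0 hL hsumN le_rfl hp₁p.le le_rfl hp₁z hzp.le le_rfl
  have hlong := hF.iterate_sub_le hL0 hL
    (hF.sum_pullback_le_one (by linarith) hFz hp hclosest hmin)
    le_rfl hzp.le le_rfl (right_mem_Icc.2 hzp.le)
  rw [← hE] at hshort hlong
  set D := deriv F^[t] p
  have hD : 0 < D := hF.deriv_iterate_pos t p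
  have h1 : p - a ≤ E * D * (p - z) := by
    rw [hp, hFz] at hlong
    linarith
  have h2 : c * (p - z) ≤ E * η * (p - a) :=
    calc c * (p - z) ≤ (F^[N' + 1] p - F^[N' + 1] p₁) * (p - z) :=
          mul_le_mul_of_nonneg_right hcN (sub_pos.2 hzp).le
      _ ≤ E * (F^[N' + 1] p - F^[N' + 1] z) * (p - p₁) := hshort
      _ ≤ E * η * (p - a) := by
          refine mul_le_mul (mul_le_mul_of_nonneg_left hsmall.le hEpos.le) (by linarith)
            (by linarith) (by positivity)
  have h3 : c * (p - a) ≤ (c * D / K) * (p - a) :=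
    calc c * (p - a) ≤ c * (E * D * (p - z)) := mul_le_mul_of_nonneg_left h1 hc.le
      _ = E * D * (c * (p - z)) := by ring
      _ ≤ E * D * (E * η * (p - a)) := mul_le_mul_of_nonneg_left h2 (by positivity)
      _ = (c * D / K) * (p - a) := by rw [hη]; field_simp
  have h4 := le_of_mul_le_mul_right h3 (sub_pos.2 hap)
  rw [le_div_iff₀ hK] at h4
  exact le_of_mul_le_mul_left h4 hc

theorem deriv_iterate_mul_of_periodic (hF : IsSmoothLift F) {p : ℝ} {t : ℕ} {m : ℤ}
    (hp : F^[t] p = p + m) (j : ℕ) : deriv F^[t * j] p = deriv F^[t] p ^ j := by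
  induction j with
  | zero => simp
  | succ j ih =>
    rw [Nat.mul_succ, Function.iterate_add, deriv_comp p (hF.differentiable.iterate _ _)
      (hF.differentiable.iterate _ _), hp, hF.deriv_iterate_add_int, ih, pow_succ]

theorem deriv_iterate_orbit (hF : IsSmoothLift F) {p : ℝ} {s : ℕ} {m : ℤ}
    (hp : F^[s] p = p + m) (i : ℕ) : deriv F^[s] (F^[i] p) = deriv F^[s] p := by
  have hd := fun n => hF.differentiable.iterate n
  have h1 : deriv (F^[s] ∘ F^[i]) p = deriv (F^[i] ∘ F^[s]) p := by
    rw [← Function.iterate_add, ← Function.iterate_add, add_comm]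
  rw [deriv_comp p (hd _ _) (hd _ _), deriv_comp p (hd _ _) (hd _ _), hp,
    hF.deriv_iterate_add_int, mul_comm] at h1
  exact mul_left_cancel₀ (hF.deriv_iterate_pos i p).ne' h1

theorem exists_le_deriv_iterate (hF : IsSmoothLift F) {φ : UnitAddCircle → UnitAddCircle}
    (hφ : ∀ x : ℝ, φ (x : UnitAddCircle) = ((F x : ℝ) : UnitAddCircle))
    (hh : IsDoublingSemiconj F h) (ha : F a = a) (hpos : ∀ x, a < x → 0 < h x)
    {K : ℝ} (hK : 1 ≤ K) :
    ∃ ε > 0, ∀ (p : ℝ) (s : ℕ), 1 ≤ s → φ^[s] (p : UnitAddCircle) = p →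
      (∃ i : ℕ, φ^[i] (p : UnitAddCircle) ∈ rightArc (a : UnitAddCircle) ε) →
      K ≤ deriv F^[s] p := by
  obtain ⟨ε, hε, H⟩ := hF.exists_le_deriv_iterate_of_closest hh ha hpos (one_pos.trans_le hK)
  refine ⟨min ε 1, lt_min hε one_pos, ?_⟩
  rintro p s hs hp ⟨i₀, τ, hτ0, hτε, hτ⟩
  rw [lt_min_iff] at hτε
  rw [← AddCircle.coe_add] at hτ
  obtain ⟨r, hr, hrc⟩ : ∃ r : UnitAddCircle → ℝ,
      (∀ y, r y ∈ Ico a (a + 1)) ∧ ∀ y, (r y : UnitAddCircle) = y :=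
    ⟨fun y => AddCircle.equivIco 1 a y, fun y => (AddCircle.equivIco 1 a y).2,
      fun y => (AddCircle.equivIco 1 a).symm_apply_apply y⟩
  have hr_eq : ∀ x ∈ Ico a (a + 1), r (x : UnitAddCircle) = x := fun x hx =>
    (AddCircle.coe_eq_coe_iff_of_mem_Ico (hr _) hx).1 (hrc _)
  have hper : Function.IsPeriodicPt φ s (p : UnitAddCircle) := hp
  obtain ⟨i, -, hi⟩ := Finset.exists_min_image (Finset.range s) (fun i => r (φ^[i] p))
    ⟨0, Finset.mem_range.2 hs⟩
  have hi : ∀ j, r (φ^[i] p) ≤ r (φ^[j] p) := fun j => by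
    rw [← hper.iterate_mod_apply j]
    exact hi _ (Finset.mem_range.2 (Nat.mod_lt _ hs))
  set p' := r (φ^[i] p) with hp'
  have hp'c : (p' : UnitAddCircle) = φ^[i] p := hrc _
  have hr₀ : r (φ^[i₀] p) = a + τ := by
    rw [hτ]
    exact hr_eq _ ⟨by linarith, by linarith⟩
  have hap' : a < p' := by
    refine lt_of_le_of_ne (hr _).1 fun hap' => ?_
    have hfix : Function.IsFixedPt φ (a : UnitAddCircle) := by
      rw [Function.IsFixedPt, hφ, ha]
    obtain ⟨n, hn⟩ : ∃ n, i₀ + i * s = n + i :=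
      ⟨i₀ + i * s - i, by have := Nat.le_mul_of_pos_right i hs; omega⟩
    have h1 : φ^[i₀ + i * s] (p : UnitAddCircle) = a := by
      rw [hn, Function.iterate_add_apply, ← hp'c, ← hap']
      exact hfix.iterate n
    rw [← hper.iterate_mod_apply, Nat.add_mul_mod_self_right, hper.iterate_mod_apply] at h1
    rw [h1, hr_eq a ⟨le_rfl, by linarith⟩] at hr₀
    linarith
  have hp'ε : p' < a + ε := (hr₀ ▸ hi i₀).trans_lt (by linarith)
  have hper' : Function.IsPeriodicPt φ s (p' : UnitAddCircle) := by
    rw [hp'c]; exact hper.apply_iterate i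
  set t := Function.minimalPeriod φ (p' : UnitAddCircle) with ht
  have ht0 : 0 < t := hper'.minimalPeriod_pos hs
  have hcoe := lift_iterate_coe hφ
  obtain ⟨m, hm⟩ : ∃ m : ℤ, F^[t] p' = p' + m := by
    rw [← unitAddCircle_coe_eq_iff, ← hcoe]
    exact Function.isPeriodicPt_minimalPeriod φ _
  have hKt : K ≤ deriv F^[t] p' := by
    refine H p' t m ht0 hap' hp'ε hm (fun j n hj => ?_) fun j hj0 hjt n hjn => ?_
    · have h1 : ((F^[j] p' + n : ℝ) : UnitAddCircle) = φ^[j + i] p := by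
        rw [Function.iterate_add_apply, ← hp'c, hcoe, unitAddCircle_coe_eq_iff]
        exact ⟨n, rfl⟩
      have h2 := hi (j + i)
      rw [← h1, hr_eq _ ⟨hj.1.le, hj.2.trans (hr _).2⟩] at h2
      exact h2.not_gt hj.2
    · have h1 : Function.IsPeriodicPt φ j (p' : UnitAddCircle) := by
        rw [Function.IsPeriodicPt, Function.IsFixedPt, hcoe, unitAddCircle_coe_eq_iff]
        exact ⟨n, hjn⟩
      exact (h1.minimalPeriod_le hj0).not_gt hjt
  obtain ⟨j, hj⟩ := hper'.minimalPeriod_dvd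
  rw [← ht] at hj
  have hj0 : j ≠ 0 := by
    rintro rfl
    omega
  obtain ⟨m', hm'⟩ : ∃ m' : ℤ, F^[s] p = p + m' := by
    rw [← unitAddCircle_coe_eq_iff, ← hcoe]
    exact hp
  obtain ⟨n, hn⟩ : ∃ n : ℤ, F^[i] p = p' + n := by
    rw [← unitAddCircle_coe_eq_iff, ← hcoe, hp'c]
  rw [← hF.deriv_iterate_orbit hm' i, hn, hF.deriv_iterate_add_int, hj,
    hF.deriv_iterate_mul_of_periodic hm]
  exact hKt.trans (le_self_pow₀ (hK.trans hKt) hj0)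

end IsSmoothLift

/-! ### Plateaus of the semiconjugacy and the set `Λ` -/

namespace IsSmoothLift

variable {F h : ℝ → ℝ} {φ : UnitAddCircle → UnitAddCircle}

theorem surjective (hF : IsSmoothLift F) : Function.Surjective F := by
  intro y
  obtain ⟨m, hm⟩ := exists_int_gt (y - F 0)
  obtain ⟨n, hn⟩ := exists_int_lt (y - F 0)
  have hint : ∀ k : ℤ, F k = F 0 + 2 * k := fun k => by
    simpa using hF.iterate_add_int 1 0 k
  obtain ⟨M, hM, hM0⟩ : ∃ M : ℤ, y - F 0 < M ∧ 0 ≤ M :=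
    ⟨max m 0, hm.trans_le (by exact_mod_cast le_max_left m 0), le_max_right _ _⟩
  obtain ⟨N, hN, hN0⟩ : ∃ N : ℤ, N < y - F 0 ∧ N ≤ 0 :=
    ⟨min n 0, lt_of_le_of_lt (by exact_mod_cast min_le_left n 0) hn, min_le_right _ _⟩
  have hM0' : (0 : ℝ) ≤ M := by exact_mod_cast hM0
  have hN0' : (N : ℝ) ≤ 0 := by exact_mod_cast hN0
  refine mem_range_of_exists_le_of_exists_ge hF.continuous ⟨N, ?_⟩ ⟨M, ?_⟩ <;>
    rw [hint] <;> linarith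

/-- The semiconjugacy is constant on lifts of periodic intervals. -/
theorem semiconj_const_of_periodicInterval (hF : IsSmoothLift F)
    (hφ : ∀ x : ℝ, φ (x : UnitAddCircle) = ((F x : ℝ) : UnitAddCircle))
    (hh : IsDoublingSemiconj F h) {t : ℕ} (ht : 1 ≤ t) {c ℓ : ℝ} (hℓ0 : 0 < ℓ) (hℓ1 : ℓ < 1)
    (hmaps : MapsTo φ^[t] (closedArc c ℓ) (closedArc c ℓ)) : h (c + ℓ) = h c := by
  have hmem : ∀ x ∈ Icc c (c + ℓ), ∃ n : ℤ, ∃ y ∈ Icc c (c + ℓ), F^[t] x = y + n := by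
    intro x hx
    obtain ⟨y, hy, hyx⟩ := hmaps ⟨x, hx, rfl⟩
    dsimp only at hyx
    rw [lift_iterate_coe hφ, eq_comm, unitAddCircle_coe_eq_iff] at hyx
    obtain ⟨n, hn⟩ := hyx
    exact ⟨n, y, hy, hn⟩
  have hc : c ≤ c + ℓ := by linarith
  obtain ⟨n, y, hy, hn⟩ := hmem c (left_mem_Icc.2 hc)
  have hright : F^[t] (c + ℓ) ≤ c + ℓ + n := by
    by_contra! hgt
    obtain ⟨w, hw1, hw2, hw3⟩ : ∃ w, c + ℓ + n < w ∧ w < c + 1 + n ∧ w ≤ F^[t] (c + ℓ) :=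
      ⟨min (F^[t] (c + ℓ)) (c + (ℓ + 1) / 2 + n), lt_min hgt (by linarith),
        (min_le_right _ _).trans_lt (by linarith), min_le_left _ _⟩
    obtain ⟨x, hx, rfl⟩ := intermediate_value_Icc hc
      (hF.differentiable.iterate t).continuous.continuousOn
      (show w ∈ Icc (F^[t] c) (F^[t] (c + ℓ)) from ⟨by linarith [hy.2], hw3⟩)
    obtain ⟨n', y', hy', hn'⟩ := hmem x hx
    have h1 : (n' : ℝ) < n + 1 := by linarith [hy'.1]
    have h2 : (n' : ℝ) ≤ n := by
      have : n' < n + 1 := by exact_mod_cast h1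
      exact_mod_cast Int.lt_add_one_iff.1 this
    linarith [hy'.2]
  have h1 := hh.monotone hright
  have h2 := hh.monotone hy.1
  have h3 := congrArg h hn
  rw [hh.add_int, hh.iterate] at h1 h3
  have h4 := hh.monotone hc
  have h5 : (1 : ℝ) < 2 ^ t := one_lt_pow₀ one_lt_two (by omega)
  nlinarith

theorem coe_notMem_lambdaSet (hF : IsSmoothLift F)
    (hφ : ∀ x : ℝ, φ (x : UnitAddCircle) = ((F x : ℝ) : UnitAddCircle))
    (hh : IsDoublingSemiconj F h) {x y z : ℝ} (hx : h x = 0) (hy : h y = 0) (hxy : x < y)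
    (hz : z ∈ Icc x y) : (z : UnitAddCircle) ∉ lambdaSet φ := by
  set S : Set ℝ := {x | h x = 0} with hS
  have hclosed : IsClosed S := isClosed_eq hh.continuous continuous_const
  have hdist : ∀ u ∈ S, ∀ v ∈ S, v < u + 1 := fun u hu v hv => hh.lt_of_lt <| by
    rw [hh.add_one, show h u = 0 from hu, show h v = 0 from hv]; norm_num
  have hbelow : BddBelow S := ⟨x - 1, fun u hu => by linarith [hdist u hu x hx]⟩
  have habove : BddAbove S := ⟨x + 1, fun u hu => (hdist x hx u hu).le⟩
  set α := sInf S with hα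
  set β := sSup S with hβ
  have hαS : α ∈ S := hclosed.csInf_mem ⟨x, hx⟩ hbelow
  have hβS : β ∈ S := hclosed.csSup_mem ⟨x, hx⟩ habove
  have hαx : α ≤ x := csInf_le hbelow hx
  have hyβ : y ≤ β := le_csSup habove hy
  have hmem : ∀ u, h u = 0 ↔ u ∈ Icc α β := by
    refine fun u => ⟨fun hu => ⟨csInf_le hbelow hu, le_csSup habove hu⟩, fun hu => ?_⟩
    exact le_antisymm ((hh.monotone hu.2).trans_eq hβS) (hαS.symm.trans_le (hh.monotone hu.1))
  have hβα : β < α + 1 := hdist α hαS β hβS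
  set I := closedArc α (β - α) with hI
  have hIcc : I = (fun t : ℝ => (t : UnitAddCircle)) '' Icc α β := by
    rw [hI, closedArc, add_sub_cancel]
  have hper : IsPeriodicInterval φ 1 I := by
    refine ⟨le_rfl, ⟨α, β - α, by linarith, by linarith, rfl⟩, ?_⟩
    rw [Function.iterate_one, hIcc]
    refine ⟨?_, ?_, ?_⟩
    · rintro _ ⟨u, hu, rfl⟩
      refine ⟨F u, ?_, (hφ u).symm⟩
      rw [← hmem] at hu ⊢
      rw [hh.semiconj, hu, mul_zero]
    · rintro _ ⟨u, hu, rfl⟩ _ ⟨v, hv, rfl⟩ huv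
      dsimp only at huv
      rw [hφ, hφ, unitAddCircle_coe_eq_iff] at huv
      obtain ⟨m, hm⟩ := huv
      rw [← hmem] at hu hv
      have h1 := congrArg h hm
      rw [hh.add_int, hh.semiconj, hh.semiconj, hu, hv] at h1
      have hm0 : (m : ℝ) = 0 := by linarith
      rw [hm0, add_zero] at hm
      dsimp only
      rw [hF.strictMono.injective hm]
    · rintro _ ⟨v, hv, rfl⟩
      obtain ⟨u, rfl⟩ := hF.surjective v
      refine ⟨u, ⟨u, ?_, rfl⟩, hφ u⟩
      rw [← hmem, hh.semiconj] at hv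
      rw [← hmem]
      linarith
  have hmax : IsMaxPeriodicInterval φ I := by
    refine ⟨⟨1, hper⟩, ?_⟩
    rintro J ⟨t, ht, ⟨c, ℓ, hℓ0, hℓ1, rfl⟩, hbij⟩ hIJ
    refine hIJ.antisymm ?_
    have hconst := hF.semiconj_const_of_periodicInterval hφ hh ht hℓ0 hℓ1 hbij.mapsTo
    have hconst' : ∀ u ∈ Icc c (c + ℓ), h u = h c := fun u hu =>
      le_antisymm ((hh.monotone hu.2).trans_eq hconst) (hh.monotone hu.1)
    obtain ⟨e, he, heα⟩ := hIJ (hIcc ▸ ⟨α, ⟨le_rfl, by linarith⟩, rfl⟩ : (α : UnitAddCircle) ∈ I)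
    obtain ⟨n, hn⟩ := (unitAddCircle_coe_eq_iff _ _).1 heα.symm
    rintro _ ⟨u, hu, rfl⟩
    rw [hIcc]
    refine ⟨u + n, ?_, ?_⟩
    · rw [← hmem, hh.add_int, hconst' u hu, ← hconst' e he, ← hh.add_int, ← hn]
      exact hαS
    · exact (unitAddCircle_coe_eq_iff _ _).2 ⟨n, rfl⟩
  refine fun hzΛ => hzΛ.2 (mem_iUnion.2 ⟨0, mem_iUnion₂.2 ⟨I, hmax, ?_⟩⟩)
  rw [hIcc]
  exact ⟨z, ⟨hαx.trans hz.1, hz.2.trans hyβ⟩, rfl⟩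

end IsSmoothLift

/-! ### Orientation reversal -/

theorem reflect_iterate (F : ℝ → ℝ) (n : ℕ) (x : ℝ) :
    (fun x => -F (-x))^[n] x = -F^[n] (-x) := by
  induction n with
  | zero => simp
  | succ k ih => rw [Function.iterate_succ_apply', Function.iterate_succ_apply', ih, neg_neg]

theorem reflect_circle_iterate (φ : UnitAddCircle → UnitAddCircle) (n : ℕ) (x : UnitAddCircle) :
    (fun x => -φ (-x))^[n] (-x) = -φ^[n] x := by
  induction n with
  | zero => simp
  | succ k ih => rw [Function.iterate_succ_apply', Function.iterate_succ_apply', ih, neg_neg]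

theorem deriv_reflect_iterate (F : ℝ → ℝ) (n : ℕ) (x : ℝ) :
    deriv (fun x => -F (-x))^[n] (-x) = deriv F^[n] x := by
  rw [funext (reflect_iterate F n), deriv.fun_neg, deriv_comp_neg, neg_neg, neg_neg]

theorem IsSmoothLift.reflect {F : ℝ → ℝ} (hF : IsSmoothLift F) :
    IsSmoothLift fun x => -F (-x) where
  contDiff := (hF.contDiff.comp contDiff_neg).neg
  deriv_pos x := by
    rw [deriv.fun_neg, deriv_comp_neg, neg_neg]
    exact hF.deriv_pos _
  add_one x := by
    have := hF.add_one (-(x + 1))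
    rw [show -(x + 1) + 1 = -x by ring] at this
    linarith

theorem IsDoublingSemiconj.reflect {F h : ℝ → ℝ} (hh : IsDoublingSemiconj F h) :
    IsDoublingSemiconj (fun x => -F (-x)) fun x => -h (-x) where
  continuous := (hh.continuous.comp continuous_neg).neg
  monotone x y hxy := neg_le_neg (hh.monotone (neg_le_neg hxy))
  add_one x := by
    have := hh.add_one (-(x + 1))
    rw [show -(x + 1) + 1 = -x by ring] at this
    linarith
  semiconj x := by rw [neg_neg, hh.semiconj]; ring

/-- Lemma 3.2: near a fixed point `x₀` accumulated by `Λ` from the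
right, periodic points of `Λ` whose orbits enter `(x₀, x₀+ε)` have large multiplier;
symmetrically on the left. Derivatives computed via the lift `F`. -/
theorem large_multiplier_near_fixed_point
    (φ : UnitAddCircle → UnitAddCircle) (F : ℝ → ℝ)
    (hF : IsLiftDeg2 φ F) (hC2 : ContDiff ℝ 2 F) (hpos : ∀ x : ℝ, 0 < deriv F x)
    (hnc : ¬ ConjugateToDoubling φ)
    (hfin : {I | IsMaxPeriodicInterval φ I}.Finite)
    (hne : {I | IsMaxPeriodicInterval φ I}.Nonempty)
    (x₀ : UnitAddCircle) (hfix : φ x₀ = x₀) :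
    ((∀ ε : ℝ, 0 < ε → (rightArc x₀ ε ∩ lambdaSet φ).Nonempty) →
      ∀ K : ℝ, 1 ≤ K → ∃ ε : ℝ, 0 < ε ∧
        ∀ (p : UnitAddCircle) (s : ℕ), 1 ≤ s → p ∈ lambdaSet φ → φ^[s] p = p →
          (∃ i : ℕ, i < s ∧ φ^[i] p ∈ rightArc x₀ ε) →
          ∀ p' : ℝ, (p' : UnitAddCircle) = p → K ≤ deriv (F^[s]) p') ∧
    ((∀ ε : ℝ, 0 < ε → (leftArc x₀ ε ∩ lambdaSet φ).Nonempty) →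
      ∀ K : ℝ, 1 ≤ K → ∃ ε : ℝ, 0 < ε ∧
        ∀ (p : UnitAddCircle) (s : ℕ), 1 ≤ s → p ∈ lambdaSet φ → φ^[s] p = p →
          (∃ i : ℕ, i < s ∧ φ^[i] p ∈ leftArc x₀ ε) →
          ∀ p' : ℝ, (p' : UnitAddCircle) = p → K ≤ deriv (F^[s]) p') := by
  obtain ⟨hcont, hmono, hone, hφ⟩ := hF
  have hS : IsSmoothLift F := ⟨hC2, hpos, hone⟩
  obtain ⟨h, hh⟩ := exists_semiconj_doubling hcont hmono hone
  obtain ⟨a, rfl, ha⟩ : ∃ a : ℝ, (a : UnitAddCircle) = x₀ ∧ F a = a := by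
    induction x₀ using QuotientAddGroup.induction_on with
    | H a₀ =>
      obtain ⟨m, hm⟩ := (unitAddCircle_coe_eq_iff _ _).1 ((hφ a₀).symm.trans hfix)
      have h1 := hS.iterate_add_int 1 a₀ (-m)
      refine ⟨a₀ + (-m : ℤ), (unitAddCircle_coe_eq_iff _ _).2 ⟨-m, rfl⟩, ?_⟩
      simp only [Function.iterate_one] at h1
      rw [h1, hm]
      push_cast
      ring
  have h0 := IsSmoothLift.semiconj_fixed_eq_zero hh ha
  constructor
  · intro hΛ K hK
    have hpos' : ∀ x, a < x → 0 < h x := by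
      refine fun x hx => lt_of_le_of_ne (h0.symm.trans_le (hh.monotone hx.le)) fun hx0 => ?_
      obtain ⟨_, ⟨τ, hτ0, hτ, rfl⟩, hy⟩ := hΛ (x - a) (sub_pos.2 hx)
      exact hS.coe_notMem_lambdaSet hφ hh h0 hx0.symm hx
        (z := a + τ) ⟨by linarith, by linarith⟩ hy
    obtain ⟨ε, hε, H⟩ := hS.exists_le_deriv_iterate hφ hh ha hpos' hK
    refine ⟨ε, hε, ?_⟩
    rintro _ s hs - hp ⟨i, -, hi⟩ p rfl
    exact H p s hs hp ⟨i, hi⟩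
  · intro hΛ K hK
    have hpos' : ∀ x, -a < x → 0 < -h (-x) := by
      intro x hx
      refine neg_pos.2 (lt_of_le_of_ne ((hh.monotone (by linarith)).trans_eq h0) fun hx0 => ?_)
      obtain ⟨_, ⟨τ, hτ0, hτ, rfl⟩, hy⟩ := hΛ (a + x) (by linarith)
      exact hS.coe_notMem_lambdaSet hφ hh hx0 h0 (by linarith)
        (z := a - τ) ⟨by linarith, by linarith⟩ hy
    have hφ' : ∀ x : ℝ, -φ (-(x : UnitAddCircle)) = ((-F (-x) : ℝ) : UnitAddCircle) := by
      intro x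
      rw [← AddCircle.coe_neg, hφ, AddCircle.coe_neg]
    obtain ⟨ε, hε, H⟩ := hS.reflect.exists_le_deriv_iterate (φ := fun x => -φ (-x)) hφ' hh.reflect
      (by simp only [neg_neg, ha]) hpos' hK
    refine ⟨ε, hε, ?_⟩
    rintro _ s hs - hp ⟨i, -, τ, hτ0, hτε, hτ⟩ p rfl
    rw [← deriv_reflect_iterate]
    refine H (-p) s hs ?_ ⟨i, τ, hτ0, hτε, ?_⟩
    · rw [AddCircle.coe_neg, reflect_circle_iterate, hp]
    · rw [AddCircle.coe_neg, reflect_circle_iterate, hτ, AddCircle.coe_neg]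
      abel
end
end
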